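/- arXiv:0811.2935 — 2 statements merged into one kernel-verified Lean document; each statement's English description precedes it below -/
import Mathlib

section
/- Let s be an integer, and let f : [0,∞) → ℂ be C^∞ with support contained in [A,B] for some 0 < A < B. For t > 0 define K_t on ((0,π)×ℝ)² by K_t((θ,φ),(θ',φ')) = Σ_{l ≥ |s|} f(t² λ_{ls}) Σ_{m=−l}^{l} ₛY_{lm}(θ,φ) conj(ₛY_{lm}(θ',φ')) (a finite sum for each t). Then for every compact set F ⊂ (0,π)×ℝ, all nonnegative integers i₁, j₁, i₂, j₂, and every nonnegative integer N, there exists c > 0 such that for all t > 0 and all x = (θ,φ), y = (θ',φ') ∈ F, |∂^{i₁}_θ ∂^{j₁}_φ ∂^{i₂}_{θ'} ∂^{j₂}_{φ'} K_t(x,y)| ≤ c · t^{−(2+i₁+j₁+i₂+j₂)} · (1 + d(p(x),p(y))/t)^{−N}, where p(θ,φ) = (sin θ cos φ, sin θ sin φ, cos θ) ∈ S² and d is the geodesic distance on S². -/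
noncomputable section

/-- Integer binomial coefficient, zero outside `0 ≤ j ≤ n`. -/
def izbinom (n j : ℤ) : ℕ := if 0 ≤ j ∧ j ≤ n then n.toNat.choose j.toNat else 0

/-- The normalization constant `a_{lm} = √((l+m)!(l−m)!(2l+1)/(4π))`. -/
noncomputable def alm (l m : ℤ) : ℝ :=
  Real.sqrt ((((l + m).toNat.factorial : ℝ) * ((l - m).toNat.factorial : ℝ) * (2 * (l : ℝ) + 1)) /
    (4 * Real.pi))

/-- The spin-`s` spherical harmonic `ₛY_{lm}` in the standard chart, as a function of `(θ, φ)`. -/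
noncomputable def sY (s l m : ℤ) (x : ℝ × ℝ) : ℂ :=
  Complex.exp (Complex.I * (m : ℂ) * (x.2 : ℂ)) * (-1 : ℂ) ^ (max (-m) 0) *
    ((alm l m / Real.sqrt (((l + s).toNat.factorial : ℝ) * ((l - s).toNat.factorial : ℝ)) : ℝ) : ℂ) *
    ((Real.sin (x.1 / 2) : ℂ)) ^ (2 * l) *
    ∑ r ∈ Finset.Icc (0 : ℤ) (l - s),
      (izbinom (l - s) r : ℂ) * (izbinom (l + s) (r + s - m) : ℂ) * (-1 : ℂ) ^ (l - r - s) *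
        ((Real.cos (x.1 / 2) / Real.sin (x.1 / 2) : ℝ) : ℂ) ^ (2 * r + s - m)
/-- Partial derivative in the first variable. -/
noncomputable def pdθ (h : ℝ × ℝ → ℂ) : ℝ × ℝ → ℂ := fun x => deriv (fun t => h (t, x.2)) x.1

/-- Partial derivative in the second variable. -/
noncomputable def pdφ (h : ℝ × ℝ → ℂ) : ℝ × ℝ → ℂ := fun x => deriv (fun t => h (x.1, t)) x.2
/-- Euclidean dot product on `ℝ³`. -/
def dot3 (v w : Fin 3 → ℝ) : ℝ := v 0 * w 0 + v 1 * w 1 + v 2 * w 2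

/-- Standard spherical coordinates. -/
noncomputable def sphCoords (θ φ : ℝ) : Fin 3 → ℝ :=
  ![Real.sin θ * Real.cos φ, Real.sin θ * Real.sin φ, Real.cos θ]

/-- Geodesic distance on the unit sphere: `d(x,y) = arccos ⟨x,y⟩`. -/
noncomputable def gd (p q : Fin 3 → ℝ) : ℝ := Real.arccos (dot3 p q)
/-- The eigenvalue `λ_{ls}`. -/
def lam (s l : ℤ) : ℤ := if 0 ≤ s then (l - s) * (l + s + 1) else (l + s) * (l - s + 1)

section TrigPoly

variable {ι : Type*} [Fintype ι]

/-- The exponential `v ↦ exp (i ⟨k, v⟩ / 2)`. -/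
def trigMonomial (k : ι → ℤ) (v : ι → ℝ) : ℂ :=
  Complex.exp (Complex.I / 2 * ∑ j, (k j : ℂ) * (v j : ℂ))

/-- Trigonometric polynomials in the half angles `v j / 2`, of degree at most `n` in each. -/
def trigPoly (ι : Type*) [Fintype ι] (n : ℕ) : Submodule ℂ ((ι → ℝ) → ℂ) :=
  Submodule.span ℂ (trigMonomial '' {k | ∀ j, |k j| ≤ n})

lemma trigPoly_mono {m n : ℕ} (h : m ≤ n) : trigPoly ι m ≤ trigPoly ι n :=
  Submodule.span_mono (Set.image_mono fun k hk j => (hk j).trans (by exact_mod_cast h))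

lemma mul_mem_trigPoly {m n : ℕ} {f g : (ι → ℝ) → ℂ} (hf : f ∈ trigPoly ι m)
    (hg : g ∈ trigPoly ι n) : f * g ∈ trigPoly ι (m + n) := by
  have h := Submodule.mul_mem_mul hf hg
  rw [trigPoly, trigPoly, Submodule.span_mul_span] at h
  refine Submodule.span_mono ?_ h
  rintro _ ⟨_, ⟨k, hk, rfl⟩, _, ⟨l, hl, rfl⟩, rfl⟩
  refine ⟨k + l, fun j => (abs_add_le _ _).trans ?_, ?_⟩
  · push_cast
    exact add_le_add (hk j) (hl j)
  · funext v
    simp only [trigMonomial, Pi.mul_apply, ← Complex.exp_add, ← mul_add, ← Finset.sum_add_distrib]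
    simp [add_mul]

lemma const_mem_trigPoly (c : ℂ) (n : ℕ) : (fun _ => c) ∈ trigPoly ι n := by
  have : (fun _ : ι → ℝ => c) = c • trigMonomial 0 := by
    funext v; simp [trigMonomial]
  rw [this]
  exact Submodule.smul_mem _ _ (Submodule.subset_span ⟨0, by simp, rfl⟩)

lemma pow_mem_trigPoly {n : ℕ} {f : (ι → ℝ) → ℂ} (hf : f ∈ trigPoly ι n) (k : ℕ) :
    f ^ k ∈ trigPoly ι (k * n) := by
  induction k with
  | zero => exact const_mem_trigPoly 1 _
  | succ k ih =>
    rw [pow_succ, Nat.succ_mul]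
    exact mul_mem_trigPoly ih hf

variable [DecidableEq ι]

/-- The partial derivative in the `i`-th coordinate. -/
def partialDeriv (i : ι) (f : (ι → ℝ) → ℂ) : (ι → ℝ) → ℂ :=
  fun v => deriv (fun r => f (Function.update v i r)) (v i)

lemma sum_update_eq (k : ι → ℤ) (v : ι → ℝ) (i : ι) (r : ℝ) :
    ∑ j, (k j : ℂ) * ((Function.update v i r j : ℝ) : ℂ) =
      k i * r + ∑ j ∈ Finset.univ.erase i, (k j : ℂ) * (v j : ℂ) := by
  rw [← Finset.add_sum_erase _ _ (Finset.mem_univ i)]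
  congr 1
  · simp
  · exact Finset.sum_congr rfl fun j hj => by simp [Finset.ne_of_mem_erase hj]

lemma exists_partialDeriv_of_mem_trigPoly (i : ι) {n : ℕ} {f : (ι → ℝ) → ℂ}
    (hf : f ∈ trigPoly ι n) :
    ∃ g ∈ trigPoly ι n, ∀ v, HasDerivAt (fun r => f (Function.update v i r)) (g v) (v i) := by
  induction hf using Submodule.span_induction with
  | mem f hf =>
    obtain ⟨k, hk, rfl⟩ := hf
    refine ⟨(Complex.I / 2 * k i) • trigMonomial k, Submodule.smul_mem _ _
      (Submodule.subset_span ⟨k, hk, rfl⟩), fun v => ?_⟩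
    have h1 : HasDerivAt (fun r : ℝ => (Complex.I / 2) *
        ((k i : ℂ) * r + ∑ j ∈ Finset.univ.erase i, (k j : ℂ) * (v j : ℂ)))
        (Complex.I / 2 * (k i * 1)) (v i) :=
      (((hasDerivAt_id (v i)).ofReal_comp.const_mul (k i : ℂ)).add_const _).const_mul _
    have h2 := h1.cexp
    simp only [← sum_update_eq] at h2
    refine h2.congr_deriv ?_
    simp [trigMonomial]
    ring
  | zero => exact ⟨0, zero_mem _, fun v => hasDerivAt_const _ _⟩
  | add f g _ _ hf hg =>
    obtain ⟨f', hf', hfd⟩ := hf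
    obtain ⟨g', hg', hgd⟩ := hg
    exact ⟨f' + g', add_mem hf' hg', fun v => (hfd v).add (hgd v)⟩
  | smul c f _ hf =>
    obtain ⟨f', hf', hfd⟩ := hf
    exact ⟨c • f', Submodule.smul_mem _ _ hf', fun v => (hfd v).const_smul c⟩

lemma hasDerivAt_partialDeriv (i : ι) {n : ℕ} {f : (ι → ℝ) → ℂ} (hf : f ∈ trigPoly ι n)
    (v : ι → ℝ) :
    HasDerivAt (fun r => f (Function.update v i r)) (partialDeriv i f v) (v i) := by
  obtain ⟨g, -, hg⟩ := exists_partialDeriv_of_mem_trigPoly i hf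
  exact (hg v).differentiableAt.hasDerivAt

lemma partialDeriv_mem_trigPoly (i : ι) {n : ℕ} {f : (ι → ℝ) → ℂ} (hf : f ∈ trigPoly ι n) :
    partialDeriv i f ∈ trigPoly ι n := by
  obtain ⟨g, hgm, hg⟩ := exists_partialDeriv_of_mem_trigPoly i hf
  have : partialDeriv i f = g := funext fun v => (hg v).deriv
  rwa [this]

lemma exists_slice_of_mem_trigPoly (i : ι) {n : ℕ} {f : (ι → ℝ) → ℂ} (hf : f ∈ trigPoly ι n)
    (v : ι → ℝ) : ∃ (F : ℂ → ℂ) (p q : Polynomial ℂ),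
      (∀ r : ℝ, F r = f (Function.update v i r)) ∧
      (∀ z, F z = Complex.exp (-(n * Complex.I / 2 * z)) * p.eval (Complex.exp (Complex.I / 2 * z))) ∧
      ∀ z, F z = Complex.exp (n * Complex.I / 2 * z) * q.eval (Complex.exp (-(Complex.I / 2 * z))) := by
  induction hf using Submodule.span_induction with
  | mem f hf =>
    obtain ⟨k, hk, rfl⟩ := hf
    have hk' := abs_le.1 (hk i)
    obtain ⟨a, ha⟩ : ∃ a : ℕ, (a : ℤ) = n + k i := ⟨(n + k i).toNat, by omega⟩
    obtain ⟨b, hb⟩ : ∃ b : ℕ, (b : ℤ) = n - k i := ⟨(n - k i).toNat, by omega⟩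
    have ha' : (a : ℂ) = n + k i := by exact_mod_cast congrArg (Int.cast (R := ℂ)) ha
    have hb' : (b : ℂ) = n - k i := by exact_mod_cast congrArg (Int.cast (R := ℂ)) hb
    set c := Complex.exp (Complex.I / 2 * ∑ j ∈ Finset.univ.erase i, (k j : ℂ) * (v j : ℂ))
    refine ⟨fun z => Complex.exp (Complex.I / 2 * (k i * z)) * c,
      Polynomial.C c * Polynomial.X ^ a, Polynomial.C c * Polynomial.X ^ b, ?_, ?_, ?_⟩
    · intro r
      rw [trigMonomial, sum_update_eq, mul_add, Complex.exp_add]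
    · intro z
      simp only [Polynomial.eval_mul, Polynomial.eval_C, Polynomial.eval_pow, Polynomial.eval_X]
      have h : Complex.exp (Complex.I / 2 * (k i * z)) =
          Complex.exp (-(n * Complex.I / 2 * z)) * Complex.exp (a * (Complex.I / 2 * z)) := by
        rw [← Complex.exp_add, ha']
        congr 1
        ring
      rw [← Complex.exp_nat_mul, h]
      ring
    · intro z
      simp only [Polynomial.eval_mul, Polynomial.eval_C, Polynomial.eval_pow, Polynomial.eval_X]
      have h : Complex.exp (Complex.I / 2 * (k i * z)) =
          Complex.exp (n * Complex.I / 2 * z) * Complex.exp (b * (-(Complex.I / 2 * z))) := by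
        rw [← Complex.exp_add, hb']
        congr 1
        ring
      rw [← Complex.exp_nat_mul, h]
      ring
  | zero => exact ⟨0, 0, 0, by simp, by simp, by simp⟩
  | add f g _ _ hf hg =>
    obtain ⟨F, p, q, h1, h2, h3⟩ := hf
    obtain ⟨F', p', q', h1', h2', h3'⟩ := hg
    exact ⟨F + F', p + p', q + q', by simp [h1, h1'],
      fun z => by rw [Polynomial.eval_add, mul_add, ← h2, ← h2']; rfl,
      fun z => by rw [Polynomial.eval_add, mul_add, ← h3, ← h3']; rfl⟩
  | smul c f _ hf =>
    obtain ⟨F, p, q, h1, h2, h3⟩ := hf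
    exact ⟨c • F, c • p, c • q, by simp [h1],
      fun z => by rw [Polynomial.eval_smul, smul_eq_mul, mul_left_comm, ← h2]; rfl,
      fun z => by rw [Polynomial.eval_smul, smul_eq_mul, mul_left_comm, ← h3]; rfl⟩

/-- The maximum principle for a polynomial on the closed unit disc. -/
lemma norm_eval_le_of_norm_exp_le {p : Polynomial ℂ} {M : ℝ}
    (hp : ∀ r : ℝ, ‖p.eval (Complex.exp (r * Complex.I))‖ ≤ M) {w : ℂ} (hw : ‖w‖ ≤ 1) :
    ‖p.eval w‖ ≤ M := by
  refine Complex.norm_le_of_forall_mem_frontier_norm_le (U := Metric.ball (0 : ℂ) 1)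
    (f := fun w => p.eval w) Metric.isBounded_ball p.differentiable.diffContOnCl ?_ ?_
  · intro z hz
    rw [frontier_ball _ one_ne_zero, mem_sphere_zero_iff_norm] at hz
    have := hp (Complex.arg z)
    have h2 := Complex.norm_mul_exp_arg_mul_I z
    rw [hz] at h2
    simp only [Complex.ofReal_one, one_mul] at h2
    rwa [h2] at this
  · rw [closure_ball _ one_ne_zero]
    simpa using hw

/-- Bernstein's inequality, with a non-sharp constant. -/
lemma norm_partialDeriv_le (i : ι) {n : ℕ} (hn : 0 < n) {f : (ι → ℝ) → ℂ}
    (hf : f ∈ trigPoly ι n) {M : ℝ} (hM : ∀ v, ‖f v‖ ≤ M) (v : ι → ℝ) :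
    ‖partialDeriv i f v‖ ≤ 2 * n * M := by
  have hM0 : 0 ≤ M := (norm_nonneg _).trans (hM v)
  obtain ⟨F, p, q, hF, hp, hq⟩ := exists_slice_of_mem_trigPoly i hf v
  have hn' : (0 : ℝ) < n := by exact_mod_cast hn
  have hFd : Differentiable ℂ F := by
    have : F = fun z => Complex.exp (-(n * Complex.I / 2 * z)) *
      p.eval (Complex.exp (Complex.I / 2 * z)) := funext hp
    rw [this]
    have := p.differentiable
    fun_prop
  have hpM : ∀ r : ℝ, ‖p.eval (Complex.exp (r * Complex.I))‖ ≤ M := by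
    intro r
    have h := hM (Function.update v i (2 * r))
    rw [← hF, hp, norm_mul, Complex.norm_exp] at h
    have e : Complex.I / 2 * ((2 * r : ℝ) : ℂ) = r * Complex.I := by push_cast; ring
    have e2 : (-(n * Complex.I / 2 * ((2 * r : ℝ) : ℂ))).re = 0 := by
      simp [Complex.mul_re]
    rwa [e2, Real.exp_zero, one_mul, e] at h
  have hqM : ∀ r : ℝ, ‖q.eval (Complex.exp (r * Complex.I))‖ ≤ M := by
    intro r
    have h := hM (Function.update v i (-2 * r))
    rw [← hF, hq, norm_mul, Complex.norm_exp] at h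
    have e : -(Complex.I / 2 * ((-2 * r : ℝ) : ℂ)) = r * Complex.I := by push_cast; ring
    have e2 : (n * Complex.I / 2 * ((-2 * r : ℝ) : ℂ)).re = 0 := by
      simp [Complex.mul_re]
    rwa [e2, Real.exp_zero, one_mul, e] at h
  have hre : ∀ z : ℂ, (Complex.I / 2 * z).re = -z.im / 2 := by
    intro z
    rw [div_mul_eq_mul_div, Complex.div_ofNat_re, Complex.I_mul_re]
  have hnat : ∀ w : ℂ, ((n : ℂ) * w).re = n * w.re := fun w => by simp
  have hexp : Real.exp (1 / 2) ≤ 2 := by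
    have h := Real.exp_one_lt_d9
    have : Real.exp (1 / 2) * Real.exp (1 / 2) = Real.exp 1 := by
      rw [← Real.exp_add]; norm_num
    nlinarith [Real.exp_pos (1 / 2 : ℝ)]
  have hbound : ∀ z ∈ Metric.sphere ((v i : ℝ) : ℂ) (1 / n), ‖F z‖ ≤ 2 * M := by
    intro z hz
    have him : |z.im| ≤ 1 / n := by
      have h1 := Complex.abs_im_le_norm (z - ((v i : ℝ) : ℂ))
      rw [← dist_eq_norm, Metric.mem_sphere.1 hz] at h1
      simpa using h1
    have him' : n * |z.im| ≤ 1 := by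
      have := mul_le_mul_of_nonneg_left him hn'.le
      rwa [mul_one_div_cancel hn'.ne'] at this
    have hle : Real.exp (n * |z.im| / 2) ≤ 2 :=
      (Real.exp_le_exp.2 (by linarith)).trans hexp
    rcases le_total 0 z.im with h0 | h0
    · rw [hp, norm_mul, Complex.norm_exp]
      refine mul_le_mul ?_ (norm_eval_le_of_norm_exp_le hpM ?_) (norm_nonneg _) two_pos.le
      · refine le_of_eq_of_le ?_ hle
        rw [abs_of_nonneg h0, mul_div_assoc, mul_assoc, Complex.neg_re,
          hnat, hre]
        ring_nf
      · rw [Complex.norm_exp, Real.exp_le_one_iff, hre]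
        linarith
    · rw [hq, norm_mul, Complex.norm_exp]
      refine mul_le_mul ?_ (norm_eval_le_of_norm_exp_le hqM ?_) (norm_nonneg _) two_pos.le
      · refine le_of_eq_of_le ?_ hle
        rw [abs_of_nonpos h0, mul_div_assoc, mul_assoc, hnat, hre]
        ring_nf
      · rw [Complex.norm_exp, Real.exp_le_one_iff, Complex.neg_re, hre]
        linarith
  have hC := Complex.norm_deriv_le_of_forall_mem_sphere_norm_le (c := ((v i : ℝ) : ℂ))
    (R := 1 / n) (by positivity) hFd.diffContOnCl hbound
  have hd : partialDeriv i f v = deriv F (v i) := by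
    have h := (hFd (v i)).hasDerivAt.comp_ofReal
    simp only [hF] at h
    exact h.deriv
  rw [hd]
  refine hC.trans (le_of_eq ?_)
  field_simp

end TrigPoly

section ZonalSum

variable {K : Type*} [Field K]

/-- The diagonal matrix coefficient `D_{p,q}` of the representation of `SU(2)` on homogeneous
polynomials of degree `p + q`, at a group element with diagonal entries `a`, `b` and off-diagonal
product `-B`. -/
def zonalSum (p q : ℕ) (a b B : K) : K :=
  ∑ k ∈ Finset.range (q + 1),
    (p.choose k : K) * (q.choose k : K) * a ^ (p - k) * b ^ (q - k) * (-B) ^ k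

lemma zonalSum_eq_sum_range {p q N : ℕ} (h : q ≤ N) (a b B : K) :
    zonalSum p q a b B = ∑ k ∈ Finset.range (N + 1),
      (p.choose k : K) * (q.choose k : K) * a ^ (p - k) * b ^ (q - k) * (-B) ^ k := by
  refine Finset.sum_subset (Finset.range_mono (by omega)) fun k _ hk => ?_
  rw [Finset.mem_range, not_lt] at hk
  rw [Nat.choose_eq_zero_of_lt (show q < k by omega)]
  simp

lemma zonalSum_comm (p q : ℕ) (a b B : K) : zonalSum p q a b B = zonalSum q p b a B := by
  rw [zonalSum_eq_sum_range (Nat.le_add_left q p), zonalSum_eq_sum_range (Nat.le_add_right p q)]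
  exact Finset.sum_congr rfl fun k _ => by ring

lemma zonalSum_one_one_zero (p q : ℕ) : zonalSum p q (1 : K) 1 0 = 1 := by
  rw [zonalSum, Finset.sum_range_succ', Finset.sum_eq_zero]
  · simp
  · intro k _
    simp

open Polynomial in
lemma sum_coeff_affine_mul (α β : K) {P : K[X]} {n : ℕ} (hP : P.natDegree ≤ n) (A B : K[X]) :
    ∑ i ∈ Finset.range (n + 1 + 1), C (((C α * X + C β) * P).coeff i) * A ^ i * B ^ (n + 1 - i) =
      (C α * A + C β * B) * ∑ i ∈ Finset.range (n + 1), C (P.coeff i) * A ^ i * B ^ (n - i) := by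
  have hc0 : ((C α * X + C β) * P).coeff 0 = β * P.coeff 0 := by
    simp [add_mul, mul_assoc]
  have hc1 : ∀ i, ((C α * X + C β) * P).coeff (i + 1) = α * P.coeff i + β * P.coeff (i + 1) := by
    intro i
    simp [add_mul, mul_assoc, coeff_X_mul]
  have hB : B * ∑ i ∈ Finset.range (n + 1), C (P.coeff i) * A ^ i * B ^ (n - i) =
      C (P.coeff 0) * B ^ (n + 1) +
      ∑ i ∈ Finset.range (n + 1), C (P.coeff (i + 1)) * A ^ (i + 1) * B ^ (n - i) := by
    have h1 : B * ∑ i ∈ Finset.range (n + 1), C (P.coeff i) * A ^ i * B ^ (n - i) =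
        ∑ i ∈ Finset.range (n + 1 + 1), C (P.coeff i) * A ^ i * B ^ (n + 1 - i) := by
      rw [Finset.sum_range_succ _ (n + 1), coeff_eq_zero_of_natDegree_lt (by omega : _ < n + 1),
        Finset.mul_sum]
      simp only [C_0, zero_mul, add_zero]
      refine Finset.sum_congr rfl fun i hi => ?_
      rw [show n + 1 - i = n - i + 1 by have := Finset.mem_range.1 hi; omega, pow_succ]
      ring
    rw [h1, Finset.sum_range_succ', add_comm]
    simp
  rw [add_mul (C α * A), mul_assoc (C β), hB, Finset.sum_range_succ', hc0, mul_assoc (C α), Finset.mul_sum,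
    Finset.mul_sum, mul_add, Finset.mul_sum]
  have : ∀ i ∈ Finset.range (n + 1), C (((C α * X + C β) * P).coeff (i + 1)) * A ^ (i + 1) *
      B ^ (n + 1 - (i + 1)) = C α * (A * (C (P.coeff i) * A ^ i * B ^ (n - i))) +
      C β * (C (P.coeff (i + 1)) * A ^ (i + 1) * B ^ (n - i)) := by
    intro i _
    rw [hc1, Nat.add_sub_add_right, C_add, C_mul, C_mul]
    ring
  rw [Finset.sum_congr rfl this, Finset.sum_add_distrib]
  simp only [C_mul, pow_zero, Nat.sub_zero]
  ring

open Polynomial in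
lemma natDegree_affine_pow_mul_le (α β γ δ : K) (p q : ℕ) :
    ((C α * X + C β) ^ q * (C γ * X + C δ) ^ p).natDegree ≤ p + q := by
  refine natDegree_mul_le.trans ?_
  have h1 := natDegree_pow_le_of_le q (natDegree_linear_le (a := α) (b := β))
  have h2 := natDegree_pow_le_of_le p (natDegree_linear_le (a := γ) (b := δ))
  omega

open Polynomial in
lemma sum_coeff_affine_pow_mul (α β γ δ : K) (p q : ℕ) (A B : K[X]) :
    ∑ i ∈ Finset.range (p + q + 1),
      C (((C α * X + C β) ^ q * (C γ * X + C δ) ^ p).coeff i) * A ^ i * B ^ (p + q - i) =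
      (C α * A + C β * B) ^ q * (C γ * A + C δ * B) ^ p := by
  induction q with
  | zero =>
    induction p with
    | zero => simp
    | succ p ih =>
      have hd := natDegree_affine_pow_mul_le α β γ δ p 0
      have := sum_coeff_affine_mul γ δ hd A B
      rw [ih] at this
      simp only [pow_zero, one_mul, add_zero] at this ⊢
      rw [pow_succ', this, pow_succ']
  | succ q ih =>
    have hd := natDegree_affine_pow_mul_le α β γ δ p q
    have := sum_coeff_affine_mul α β hd A B
    rw [ih] at this
    simp only [← add_assoc]
    rw [pow_succ', mul_assoc, this, pow_succ', mul_assoc]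

open Polynomial in
lemma coeff_affine_pow_mul_scale (α β γ δ z w : K) (p q i : ℕ) (hi : i ≤ p + q) :
    ((C (α * z) * X + C (β * w)) ^ q * (C (γ * z) * X + C (δ * w)) ^ p).coeff i =
      z ^ i * w ^ (p + q - i) * ((C α * X + C β) ^ q * (C γ * X + C δ) ^ p).coeff i := by
  have h := congrArg (fun P : K[X] => P.coeff i)
    (sum_coeff_affine_pow_mul α β γ δ p q (C z * X) (C w))
  simp only [finsetSum_coeff, ← mul_assoc, ← C_mul] at h
  rw [← h]
  have : ∀ m ∈ Finset.range (p + q + 1),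
      (C (((C α * X + C β) ^ q * (C γ * X + C δ) ^ p).coeff m) * (C z * X) ^ m *
        C w ^ (p + q - m)).coeff i = if i = m then
        z ^ m * w ^ (p + q - m) * ((C α * X + C β) ^ q * (C γ * X + C δ) ^ p).coeff m else 0 := by
    intro m _
    rw [mul_pow, ← C_pow, ← C_pow, ← mul_assoc, ← C_mul, mul_right_comm, ← C_mul,
      coeff_C_mul_X_pow]
    split_ifs <;> ring
  rw [Finset.sum_congr rfl this, Finset.sum_ite_eq, if_pos (by simpa [Nat.lt_succ_iff] using hi)]

variable [CharZero K]

lemma choose_identity (p r k : ℕ) :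
    ((p : K) + 1) * ((p + 1).choose (k + 1) : K) * ((r + 1).choose (k + 1) : K) -
      (p + r + 2) * (p.choose (k + 1) : K) * ((r + 1).choose (k + 1) : K) +
      (r + 1) * (p.choose (k + 1) : K) * (r.choose (k + 1) : K) =
      (r + 1) * (p.choose k : K) * (r.choose k : K) := by
  have h1 : ((p + 1).choose (k + 1) : K) = p.choose k + p.choose (k + 1) := by
    exact_mod_cast Nat.choose_succ_succ p k
  have h2 : ((r + 1).choose (k + 1) : K) = r.choose k + r.choose (k + 1) := by
    exact_mod_cast Nat.choose_succ_succ r k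
  have h3 : ((p.choose (k + 1) : K)) * (k + 1) = p.choose k * (p - k) := by
    rcases le_or_gt k p with h | h
    · have := Nat.choose_succ_right_eq p k
      have h' : (p.choose (k + 1) : K) * ((k + 1 : ℕ) : K) = p.choose k * ((p - k : ℕ) : K) := by
        exact_mod_cast this
      rw [Nat.cast_sub h] at h'
      exact_mod_cast h'
    · rw [Nat.choose_eq_zero_of_lt h, Nat.choose_eq_zero_of_lt (by omega)]
      simp
  have h4 : ((r + 1 : K)) * r.choose k = (r + 1).choose (k + 1) * (k + 1) := by
    exact_mod_cast Nat.add_one_mul_choose_eq r k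
  have h5 : ((r : K) + 1) * r.choose (k + 1) = (r - k) * (r + 1).choose (k + 1) := by
    linear_combination (-(r + 1 : K)) * h2 - h4
  rw [h1]
  linear_combination ((p.choose (k + 1) : K)) * h5 - ((r + 1).choose (k + 1) : K) * h3
    - (p.choose k : K) * h4

lemma mul_zonalSum_left (p q : ℕ) {a b B : K} (h : a * b + B = 1) :
    ((p : K) + q + 1) * (a * zonalSum p q a b B) =
      (p + 1) * zonalSum (p + 1) q a b B + q * zonalSum p (q - 1) a b B := by
  rcases q with _ | r
  · simp only [zonalSum, zero_add, Finset.sum_range_one, Nat.choose_zero_right, Nat.sub_zero, pow_succ,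
      pow_zero, Nat.cast_zero, Nat.cast_one]
    ring
  set X : ℕ → K := fun k =>
    (p + 1) * (((p + 1).choose k : K) * ((r + 1).choose k : K) * a ^ (p + 1 - k) *
      b ^ (r + 1 - k) * (-B) ^ k) -
    (p + r + 2) * (a * ((p.choose k : K) * ((r + 1).choose k : K) * a ^ (p - k) *
      b ^ (r + 1 - k) * (-B) ^ k)) +
    (r + 1) * (a * b * ((p.choose k : K) * (r.choose k : K) * a ^ (p - k) *
      b ^ (r - k) * (-B) ^ k)) with hX
  have h0 : X 0 = 0 := by
    simp only [hX, Nat.choose_zero_right, Nat.sub_zero, pow_zero, pow_succ]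
    push_cast
    ring
  have h1 : ∀ k, X (k + 1) = -B * ((r + 1) * ((p.choose k : K) * (r.choose k : K) *
      a ^ (p - k) * b ^ (r - k) * (-B) ^ k)) := by
    intro k
    have e1 : a * ((p.choose (k + 1) : K) * a ^ (p - (k + 1))) =
        (p.choose (k + 1) : K) * a ^ (p - k) := by
      rcases Nat.lt_or_ge k p with hk | hk
      · rw [show p - k = p - (k + 1) + 1 by omega, pow_succ]; ring
      · rw [Nat.choose_eq_zero_of_lt (by omega)]; simp
    have e2 : b * ((r.choose (k + 1) : K) * b ^ (r - (k + 1))) =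
        (r.choose (k + 1) : K) * b ^ (r - k) := by
      rcases Nat.lt_or_ge k r with hk | hk
      · rw [show r - k = r - (k + 1) + 1 by omega, pow_succ]; ring
      · rw [Nat.choose_eq_zero_of_lt (by omega)]; simp
    have hc := choose_identity (K := K) p r k
    simp only [hX, Nat.add_sub_add_right, pow_succ]
    linear_combination (a ^ (p - k) * b ^ (r - k) * ((-B) ^ k * (-B))) * hc
      - (p + r + 2) * ((r + 1).choose (k + 1) : K) * b ^ (r - k) * ((-B) ^ k * (-B)) * e1
      + (r + 1) * ((-B) ^ k * (-B)) * b * ((r.choose (k + 1) : K) * b ^ (r - (k + 1))) * e1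
      + (r + 1) * ((-B) ^ k * (-B)) * (p.choose (k + 1) : K) * a ^ (p - k) * e2
  have hsum : ∑ k ∈ Finset.range (r + 1 + 1), X k = -B * ((r + 1) * zonalSum p r a b B) := by
    rw [Finset.sum_range_succ', h0, add_zero, Finset.sum_congr rfl fun k _ => h1 k,
      ← Finset.mul_sum, ← Finset.mul_sum]
    rfl
  have hsplit : ∑ k ∈ Finset.range (r + 1 + 1), X k =
      (p + 1) * zonalSum (p + 1) (r + 1) a b B - (p + r + 2) * (a * zonalSum p (r + 1) a b B) +
      (r + 1) * (a * b * zonalSum p r a b B) := by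
    rw [zonalSum_eq_sum_range (Nat.le_succ r), zonalSum, zonalSum]
    simp only [hX, Finset.sum_add_distrib, Finset.sum_sub_distrib, Finset.mul_sum]
  rw [hsplit] at hsum
  simp only [Nat.add_sub_cancel]
  push_cast
  linear_combination -hsum + (r + 1) * zonalSum p r a b B * h

lemma mul_zonalSum_right (p q : ℕ) {a b B : K} (h : a * b + B = 1) :
    ((p : K) + q + 1) * (b * zonalSum p q a b B) =
      (q + 1) * zonalSum p (q + 1) a b B + p * zonalSum (p - 1) q a b B := by
  have := mul_zonalSum_left q p (a := b) (b := a) (B := B) (by rw [mul_comm]; exact h)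
  simp only [zonalSum_comm q, zonalSum_comm (q + 1)] at this
  linear_combination this

/-- The three-term recurrence in the degree, in divergence form. -/
lemma zonalSum_recurrence (p q : ℕ) {a b B : K} (h : a * b + B = 1) :
    ((p : K) + q + 1) * (2 * B * zonalSum p q a b B) =
      2 * ((p + 1) * (q + 1) / (p + q + 2)) *
        (zonalSum p q a b B - zonalSum (p + 1) (q + 1) a b B) +
      2 * (p * q / (p + q)) * (zonalSum p q a b B - zonalSum (p - 1) (q - 1) a b B) := by
  have h1 := mul_zonalSum_left p q h
  have h2 := mul_zonalSum_right (p + 1) q h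
  simp only [Nat.add_sub_cancel] at h2
  push_cast at h2
  have h3 : ((p : K) + q) * (b * (q * zonalSum p (q - 1) a b B)) =
      q * (q * zonalSum p q a b B + p * zonalSum (p - 1) (q - 1) a b B) := by
    rcases q with _ | r
    · simp
    · have := mul_zonalSum_right p r h
      simp only [Nat.add_sub_cancel]
      push_cast
      linear_combination (r + 1 : K) * this
  have hpq2 : (p : K) + q + 2 ≠ 0 := by exact_mod_cast (show p + q + 2 ≠ 0 by omega)
  have hB : B = 1 - a * b := by linear_combination h
  by_cases h0 : p + q = 0
  · obtain ⟨rfl, rfl⟩ : p = 0 ∧ q = 0 := by omega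
    simp [zonalSum, Finset.sum_range_succ, hB]
    ring
  · have hpq : (p : K) + q ≠ 0 := by exact_mod_cast h0
    have e2 : b * zonalSum (p + 1) q a b B = ((q + 1) * zonalSum (p + 1) (q + 1) a b B +
        (p + 1) * zonalSum p q a b B) / (p + q + 2) := by
      rw [eq_div_iff hpq2]; linear_combination h2
    have e3 : b * (q * zonalSum p (q - 1) a b B) =
        q * (q * zonalSum p q a b B + p * zonalSum (p - 1) (q - 1) a b B) / (p + q) := by
      rw [eq_div_iff hpq]; linear_combination h3
    have e1 : ((p : K) + q + 1) * (a * b * zonalSum p q a b B) =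
        (p + 1) * (((q + 1) * zonalSum (p + 1) (q + 1) a b B +
        (p + 1) * zonalSum p q a b B) / (p + q + 2)) +
        q * (q * zonalSum p q a b B + p * zonalSum (p - 1) (q - 1) a b B) / (p + q) := by
      rw [← e2, ← e3]; linear_combination b * h1
    have e4 : ((p : K) + q + 1) * (2 * B * zonalSum p q a b B) = 2 * (p + q + 1) *
        zonalSum p q a b B - 2 * (((p : K) + q + 1) * (a * b * zonalSum p q a b B)) := by
      generalize zonalSum p q a b B = Z
      rw [hB]; ring
    rw [e4, e1]
    field_simp
    ring

section Pairing

open Polynomial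

lemma coeff_affine_pow (a b : K) (n k : ℕ) :
    ((C a * X + C b) ^ n).coeff k = (n.choose k : K) * a ^ k * b ^ (n - k) := by
  rw [add_pow, finsetSum_coeff]
  have : ∀ m ∈ Finset.range (n + 1), ((C a * X) ^ m * C b ^ (n - m) * (n.choose m : K[X])).coeff k =
      if k = m then (n.choose m : K) * a ^ m * b ^ (n - m) else 0 := by
    intro m _
    rw [mul_pow, ← C_pow, ← C_pow, ← C_eq_natCast, mul_right_comm, mul_assoc, mul_right_comm,
      ← C_mul, ← C_mul, coeff_C_mul_X_pow]
    split_ifs <;> ring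
  rw [Finset.sum_congr rfl this, Finset.sum_ite_eq]
  split_ifs with h
  · rfl
  · rw [Nat.choose_eq_zero_of_lt (by simpa using h)]; simp

lemma choose_mul_coeff_affine (α β γ δ : K) (p q i : ℕ) (hi : i ≤ p + q) :
    ((p + q).choose q : K) * ((C α * X + C β) ^ q * (C γ * X + C δ) ^ p).coeff i =
      ((p + q).choose i : K) *
        ((C α * X + C γ) ^ i * (C β * X + C δ) ^ (p + q - i)).coeff q := by
  have key : C ((p + q).choose q : K) * ((C α * X + C β) ^ q * (C γ * X + C δ) ^ p) =
      ∑ i ∈ Finset.range (p + q + 1), C (((p + q).choose i : K) *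
        ((C α * X + C γ) ^ i * (C β * X + C δ) ^ (p + q - i)).coeff q) * X ^ i := by
    refine Polynomial.funext fun x => ?_
    have h1 : (C (α * x + β) * X + C (γ * x + δ) : K[X]) =
        C x * (C α * X + C γ) + (C β * X + C δ) := by
      simp only [C_add, C_mul]; ring
    have h2 := congrArg (fun P : K[X] => (P ^ (p + q)).coeff q) h1
    simp only [coeff_affine_pow, Nat.add_sub_cancel] at h2
    rw [add_pow (C x * (C α * X + C γ)), finsetSum_coeff] at h2
    rw [eval_finsetSum]
    simp only [eval_mul, eval_C, eval_pow, eval_add, eval_X]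
    rw [← mul_assoc, h2]
    refine Finset.sum_congr rfl fun m _ => ?_
    rw [mul_pow, ← C_pow, ← C_eq_natCast, mul_comm _ (C _), mul_assoc, ← mul_assoc (C _),
      ← C_mul, mul_assoc, coeff_C_mul]
    ring
  have := congrArg (fun P : K[X] => P.coeff i) key
  simp only [coeff_C_mul, finsetSum_coeff, coeff_X_pow] at this
  rw [this]
  simp [Nat.lt_succ_of_le hi]

/-- The Bombieri pairing of two products of powers of linear forms. -/
lemma sum_factorial_mul_coeff_mul_coeff (α β γ δ α' β' γ' δ' : K) (p q : ℕ) :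
    ∑ i ∈ Finset.range (p + q + 1), ((i.factorial : K) * ((p + q - i).factorial : K)) *
      (((C α * X + C β) ^ q * (C γ * X + C δ) ^ p).coeff i *
        ((C α' * X + C β') ^ q * (C γ' * X + C δ') ^ p).coeff i) =
      (p.factorial : K) * (q.factorial : K) *
        zonalSum p q (γ * γ' + δ * δ') (α * α' + β * β')
          (-((α * γ' + β * δ') * (γ * α' + δ * β'))) := by
  have hch : ((p + q).choose q : K) ≠ 0 := by
    exact_mod_cast (Nat.choose_pos (Nat.le_add_left q p)).ne'
  apply mul_left_cancel₀ hch
  have hfac : ((p + q).choose q : K) * ((p.factorial : K) * (q.factorial : K)) =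
      ((p + q).factorial : K) := by
    have := Nat.choose_mul_factorial_mul_factorial (Nat.le_add_left q p)
    rw [Nat.add_sub_cancel] at this
    rw [mul_comm (p.factorial : K), ← mul_assoc]
    exact_mod_cast this
  rw [← mul_assoc, hfac, Finset.mul_sum]
  have h1 : ∀ i ∈ Finset.range (p + q + 1),
      ((p + q).choose q : K) * (((i.factorial : K) * ((p + q - i).factorial : K)) *
      (((C α * X + C β) ^ q * (C γ * X + C δ) ^ p).coeff i *
        ((C α' * X + C β') ^ q * (C γ' * X + C δ') ^ p).coeff i)) =
      ((p + q).factorial : K) * (C (((C α' * X + C β') ^ q * (C γ' * X + C δ') ^ p).coeff i) *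
        (C α * X + C γ) ^ i * (C β * X + C δ) ^ (p + q - i)).coeff q := by
    intro i hi
    have hi' : i ≤ p + q := Nat.lt_succ_iff.1 (Finset.mem_range.1 hi)
    have h2 := choose_mul_coeff_affine α β γ δ p q i hi'
    have h3 : ((p + q).choose i : K) * (i.factorial : K) * ((p + q - i).factorial : K) =
        ((p + q).factorial : K) := by
      exact_mod_cast Nat.choose_mul_factorial_mul_factorial hi'
    rw [mul_assoc (C _), coeff_C_mul, ← h3]
    linear_combination ((i.factorial : K) * ((p + q - i).factorial : K)) *
      ((C α' * X + C β') ^ q * (C γ' * X + C δ') ^ p).coeff i * h2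
  rw [Finset.sum_congr rfl h1, ← Finset.mul_sum, ← finsetSum_coeff, sum_coeff_affine_pow_mul]
  congr 1
  have e1 : (C α' * (C α * X + C γ) + C β' * (C β * X + C δ) : K[X]) =
      C (α * α' + β * β') * X + C (γ * α' + δ * β') := by
    simp only [C_add, C_mul]; ring
  have e2 : (C γ' * (C α * X + C γ) + C δ' * (C β * X + C δ) : K[X]) =
      C (α * γ' + β * δ') * X + C (γ * γ' + δ * δ') := by
    simp only [C_add, C_mul]; ring
  rw [e1, e2, coeff_mul, ← Finset.Nat.sum_antidiagonal_swap,
    Finset.Nat.sum_antidiagonal_eq_sum_range_succ_mk, zonalSum]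
  refine Finset.sum_congr rfl fun k hk => ?_
  have hk' : k ≤ q := Nat.lt_succ_iff.1 (Finset.mem_range.1 hk)
  simp only [Prod.swap, coeff_affine_pow, neg_neg, mul_pow]
  rw [Nat.choose_symm hk', Nat.sub_sub_self hk']
  ring

end Pairing

end ZonalSum

section SpinCoeff

open Polynomial

/-- The coefficients of `(c X - σ) ^ q (σ X + c) ^ p`. -/
def spinCoeff {K : Type*} [Field K] (p q i : ℕ) (c σ : K) : K :=
  ((C c * X + C (-σ)) ^ q * (C σ * X + C c) ^ p).coeff i

lemma spinCoeff_ofReal (p q i : ℕ) (c σ : ℝ) :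
    ((spinCoeff p q i c σ : ℝ) : ℂ) = spinCoeff p q i (c : ℂ) (σ : ℂ) := by
  have h := coeff_map Complex.ofRealHom i
    (p := (C c * X + C (-σ)) ^ q * (C σ * X + C c) ^ p)
  simp only [Polynomial.map_mul, Polynomial.map_pow, Polynomial.map_add, map_C, map_X] at h
  simp only [spinCoeff]
  rw [← Complex.ofRealHom_eq_coe, ← h]
  simp

lemma spinCoeff_eq_sum {K : Type*} [Field K] [CharZero K] (p q i : ℕ) (c σ : K) :
    spinCoeff p q i c σ = ∑ r ∈ Finset.range (i + 1),
      ((q.choose r : K) * c ^ r * (-σ) ^ (q - r)) *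
        ((p.choose (i - r) : K) * σ ^ (i - r) * c ^ (p - (i - r))) := by
  rw [spinCoeff, coeff_mul, Finset.Nat.sum_antidiagonal_eq_sum_range_succ_mk]
  simp only [coeff_affine_pow]

lemma sum_Icc_add_eq_sum_range {M : Type*} [AddCommMonoid M] (g : ℤ → M) (a : ℤ) (n : ℕ) :
    ∑ m ∈ Finset.Icc a (a + n), g m = ∑ i ∈ Finset.range (n + 1), g (a + i) := by
  refine Finset.sum_nbij' (fun m => (m - a).toNat) (fun i => a + i) ?_ ?_ ?_ ?_ ?_
  · intro m hm; rw [Finset.mem_Icc] at hm; rw [Finset.mem_range]; omega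
  · intro i hi; rw [Finset.mem_range] at hi; rw [Finset.mem_Icc]; omega
  · intro m hm; rw [Finset.mem_Icc] at hm; omega
  · intro i hi; omega
  · intro m hm; rw [Finset.mem_Icc] at hm
    congr 1; omega

lemma sin_pow_mul_sum_eq_spinCoeff {l s m : ℤ} {p q i : ℕ} (hp : l + s = p) (hq : l - s = q)
    (hi : l + m = i) {c σ : ℝ} (hσ : σ ≠ 0) :
    (σ : ℂ) ^ (2 * l) * ∑ r ∈ Finset.Icc (0 : ℤ) (l - s),
      (izbinom (l - s) r : ℂ) * (izbinom (l + s) (r + s - m) : ℂ) * (-1 : ℂ) ^ (l - r - s) *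
        ((c / σ : ℝ) : ℂ) ^ (2 * r + s - m) = ((spinCoeff p q i c σ : ℝ) : ℂ) := by
  have hσ' : (σ : ℂ) ≠ 0 := by exact_mod_cast hσ
  rw [spinCoeff_ofReal, spinCoeff_eq_sum, Finset.mul_sum]
  have hIcc := sum_Icc_add_eq_sum_range (fun r => (σ : ℂ) ^ (2 * l) *
    ((izbinom (l - s) r : ℂ) * (izbinom (l + s) (r + s - m) : ℂ) * (-1 : ℂ) ^ (l - r - s) *
        ((c / σ : ℝ) : ℂ) ^ (2 * r + s - m))) 0 q
  rw [zero_add, ← hq] at hIcc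
  rw [hIcc]
  simp only [zero_add]
  rw [← Finset.sum_subset (s₁ := Finset.range (min q i + 1)) (s₂ := Finset.range (q + 1))
    (Finset.range_mono (by omega)), ← Finset.sum_subset (s₁ := Finset.range (min q i + 1))
    (s₂ := Finset.range (i + 1)) (Finset.range_mono (by omega))]
  · refine Finset.sum_congr rfl fun r hr => ?_
    rw [Finset.mem_range] at hr
    obtain ⟨a, rfl⟩ : ∃ a, q = r + a := ⟨q - r, by omega⟩
    obtain ⟨b, rfl⟩ : ∃ b, i = r + b := ⟨i - r, by omega⟩
    have e1 : izbinom (l - s) r = (r + a).choose r := by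
      rw [izbinom, if_pos (by omega), hq, Int.toNat_natCast, Int.toNat_natCast]
    rw [e1, show l - r - s = (a : ℕ) by push_cast at *; omega]
    simp only [Nat.add_sub_cancel_left, zpow_natCast]
    by_cases hb : b ≤ p
    · obtain ⟨d, rfl⟩ : ∃ d, p = b + d := ⟨p - b, by omega⟩
      have e2 : izbinom (l + s) (r + s - m) = (b + d).choose b := by
        rw [izbinom, if_pos (by push_cast at *; omega), hp,
          show (r : ℤ) + s - m = (d : ℕ) by push_cast at *; omega, Int.toNat_natCast,
          Int.toNat_natCast, Nat.choose_symm_add]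
      rw [e2, show 2 * (r : ℤ) + s - m = ((r + d : ℕ) : ℤ) by push_cast at *; omega,
        show 2 * l = ((r + d + (a + b) : ℕ) : ℤ) by push_cast at *; omega, zpow_natCast,
        zpow_natCast, Nat.add_sub_cancel_left, Complex.ofReal_div, div_pow, neg_pow (σ : ℂ), pow_add _ (r + d)]
      field_simp
      ring
    · have e2 : izbinom (l + s) (r + s - m) = 0 := by
        rw [izbinom, if_neg (by push_cast at *; omega)]
      rw [e2, Nat.choose_eq_zero_of_lt (by omega : p < b)]
      simp
  · intro r hr hr'
    rw [Finset.mem_range] at hr hr'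
    rw [Nat.choose_eq_zero_of_lt (by omega : q < r)]
    simp
  · intro r hr hr'
    rw [Finset.mem_range] at hr hr'
    have e2 : izbinom (l + s) (r + s - m) = 0 := by
      rw [izbinom, if_neg (by omega)]
    rw [e2]
    simp

lemma sY_eq_spinCoeff {l s m : ℤ} {p q i : ℕ} (hp : l + s = p) (hq : l - s = q)
    (hi : l + m = i) {x : ℝ × ℝ} (hx : Real.sin (x.1 / 2) ≠ 0) :
    sY s l m x = Complex.exp (Complex.I * m * x.2) * (-1 : ℂ) ^ (max (-m) 0) *
      ((alm l m / Real.sqrt (p.factorial * q.factorial) : ℝ) : ℂ) *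
      ((spinCoeff p q i (Real.cos (x.1 / 2)) (Real.sin (x.1 / 2)) : ℝ) : ℂ) := by
  rw [← sin_pow_mul_sum_eq_spinCoeff hp hq hi hx, sY, hp, hq]
  simp only [Int.toNat_natCast]
  ring

end SpinCoeff

section Kernel

/-- The diagonal entry `cos (θ/2) cos (θ'/2) e^{i(φ-φ')/2} + sin (θ/2) sin (θ'/2) e^{-i(φ-φ')/2}` of
the relative rotation of the frames at `(θ, φ)` and `(θ', φ')`. -/
def frameDiag (v : Fin 4 → ℝ) : ℂ :=
  (Real.cos (v 0 / 2) * Real.cos (v 2 / 2) : ℝ) * Complex.exp (Complex.I / 2 * (v 1 - v 3)) +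
    (Real.sin (v 0 / 2) * Real.sin (v 2 / 2) : ℝ) * Complex.exp (-(Complex.I / 2 * (v 1 - v 3)))

/-- The complex conjugate of `frameDiag`. -/
def frameDiagConj (v : Fin 4 → ℝ) : ℂ :=
  (Real.sin (v 0 / 2) * Real.sin (v 2 / 2) : ℝ) * Complex.exp (Complex.I / 2 * (v 1 - v 3)) +
    (Real.cos (v 0 / 2) * Real.cos (v 2 / 2) : ℝ) * Complex.exp (-(Complex.I / 2 * (v 1 - v 3)))

/-- Half the squared chordal distance `1 - ⟨p(θ, φ), p(θ', φ')⟩`, where `v = (θ, φ, θ', φ')`. -/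
def chordSq (v : Fin 4 → ℝ) : ℝ :=
  1 - (Real.sin (v 0) * Real.sin (v 2) * Real.cos (v 1 - v 3) + Real.cos (v 0) * Real.cos (v 2))

/-- The value at `v = (θ, φ, θ', φ')` of the normalized zonal kernel. -/
def zonal (p q : ℕ) (v : Fin 4 → ℝ) : ℂ :=
  zonalSum p q (frameDiagConj v) (frameDiag v) ((chordSq v : ℂ) / 2)

lemma frame_offDiag_eq (v : Fin 4 → ℝ) :
    -(((Real.cos (v 0 / 2) : ℂ) * Complex.exp (Complex.I / 2 * (v 1 - v 3)) * Real.sin (v 2 / 2) +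
      -(Real.sin (v 0 / 2) : ℂ) * Complex.exp (-(Complex.I / 2 * (v 1 - v 3))) * Real.cos (v 2 / 2)) *
    ((Real.sin (v 0 / 2) : ℂ) * Complex.exp (Complex.I / 2 * (v 1 - v 3)) * Real.cos (v 2 / 2) +
      (Real.cos (v 0 / 2) : ℂ) * Complex.exp (-(Complex.I / 2 * (v 1 - v 3))) *
        (-(Real.sin (v 2 / 2) : ℂ)))) = (chordSq v : ℂ) / 2 := by
  have hc : ((Real.cos (v 1 - v 3) : ℝ) : ℂ) = (Complex.exp (Complex.I / 2 * (v 1 - v 3)) ^ 2 +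
      Complex.exp (-(Complex.I / 2 * (v 1 - v 3))) ^ 2) / 2 := by
    rw [Complex.ofReal_cos, Complex.cos, ← Complex.exp_nat_mul, ← Complex.exp_nat_mul]
    push_cast
    ring_nf
  have hz : Complex.exp (Complex.I / 2 * (v 1 - v 3)) *
      Complex.exp (-(Complex.I / 2 * (v 1 - v 3))) = 1 := by
    rw [← Complex.exp_add, add_neg_cancel, Complex.exp_zero]
  have h0 : ((Real.sin (v 0 / 2) : ℝ) : ℂ) ^ 2 + ((Real.cos (v 0 / 2) : ℝ) : ℂ) ^ 2 = 1 := by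
    exact_mod_cast Real.sin_sq_add_cos_sq (v 0 / 2)
  have h2 : ((Real.sin (v 2 / 2) : ℝ) : ℂ) ^ 2 + ((Real.cos (v 2 / 2) : ℝ) : ℂ) ^ 2 = 1 := by
    exact_mod_cast Real.sin_sq_add_cos_sq (v 2 / 2)
  have s0 : Real.sin (v 0) = 2 * Real.sin (v 0 / 2) * Real.cos (v 0 / 2) := by
    rw [← Real.sin_two_mul]; ring_nf
  have s2 : Real.sin (v 2) = 2 * Real.sin (v 2 / 2) * Real.cos (v 2 / 2) := by
    rw [← Real.sin_two_mul]; ring_nf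
  have c0 : Real.cos (v 0) = Real.cos (v 0 / 2) ^ 2 - Real.sin (v 0 / 2) ^ 2 := by
    rw [← Real.cos_two_mul']; ring_nf
  have c2 : Real.cos (v 2) = Real.cos (v 2 / 2) ^ 2 - Real.sin (v 2 / 2) ^ 2 := by
    rw [← Real.cos_two_mul']; ring_nf
  rw [chordSq, s0, s2, c0, c2]
  simp only [Complex.ofReal_sub, Complex.ofReal_add, Complex.ofReal_mul, hc, Complex.ofReal_one,
    Complex.ofReal_pow, Complex.ofReal_ofNat]
  generalize Complex.exp (Complex.I / 2 * (v 1 - v 3)) = z at *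
  generalize Complex.exp (-(Complex.I / 2 * (v 1 - v 3))) = w at *
  generalize ((Real.sin (v 0 / 2) : ℝ) : ℂ) = a at *
  generalize ((Real.cos (v 0 / 2) : ℝ) : ℂ) = b at *
  generalize ((Real.sin (v 2 / 2) : ℝ) : ℂ) = a' at *
  generalize ((Real.cos (v 2 / 2) : ℝ) : ℂ) = b' at *
  linear_combination (b ^ 2 * a' ^ 2 + a ^ 2 * b' ^ 2) * hz + (a' ^ 2 + b' ^ 2) / 2 * h0 + h2 / 2

lemma frameDiag_mul (v : Fin 4 → ℝ) :
    frameDiagConj v * frameDiag v + (chordSq v : ℂ) / 2 = 1 := by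
  rw [← frame_offDiag_eq, frameDiag, frameDiagConj]
  have hz : Complex.exp (Complex.I / 2 * (v 1 - v 3)) *
      Complex.exp (-(Complex.I / 2 * (v 1 - v 3))) = 1 := by
    rw [← Complex.exp_add, add_neg_cancel, Complex.exp_zero]
  have h0 : ((Real.sin (v 0 / 2) : ℝ) : ℂ) ^ 2 + ((Real.cos (v 0 / 2) : ℝ) : ℂ) ^ 2 = 1 := by
    exact_mod_cast Real.sin_sq_add_cos_sq (v 0 / 2)
  have h2 : ((Real.sin (v 2 / 2) : ℝ) : ℂ) ^ 2 + ((Real.cos (v 2 / 2) : ℝ) : ℂ) ^ 2 = 1 := by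
    exact_mod_cast Real.sin_sq_add_cos_sq (v 2 / 2)
  simp only [Complex.ofReal_mul]
  generalize Complex.exp (Complex.I / 2 * (v 1 - v 3)) = z at *
  generalize Complex.exp (-(Complex.I / 2 * (v 1 - v 3))) = w at *
  generalize ((Real.sin (v 0 / 2) : ℝ) : ℂ) = a at *
  generalize ((Real.cos (v 0 / 2) : ℝ) : ℂ) = b at *
  generalize ((Real.sin (v 2 / 2) : ℝ) : ℂ) = a' at *
  generalize ((Real.cos (v 2 / 2) : ℝ) : ℂ) = b' at *
  linear_combination ((a ^ 2 + b ^ 2) * (a' ^ 2 + b' ^ 2)) * hz + (a' ^ 2 + b' ^ 2) * h0 + h2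

lemma zonal_recurrence (p q : ℕ) (v : Fin 4 → ℝ) :
    ((p : ℂ) + q + 1) * (chordSq v * zonal p q v) =
      2 * ((p + 1) * (q + 1) / (p + q + 2)) * (zonal p q v - zonal (p + 1) (q + 1) v) +
      2 * (p * q / (p + q)) * (zonal p q v - zonal (p - 1) (q - 1) v) := by
  have := zonalSum_recurrence p q (frameDiag_mul v)
  rw [mul_div_cancel₀ _ two_ne_zero] at this
  exact this

lemma sum_factorial_mul_spinCoeff (p q : ℕ) (v : Fin 4 → ℝ) :
    ∑ i ∈ Finset.range (p + q + 1), ((i.factorial : ℂ) * ((p + q - i).factorial : ℂ)) *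
      (Complex.exp (Complex.I / 2 * (v 1 - v 3)) ^ i *
        Complex.exp (-(Complex.I / 2 * (v 1 - v 3))) ^ (p + q - i) *
        (spinCoeff p q i (Real.cos (v 0 / 2) : ℂ) (Real.sin (v 0 / 2) : ℂ) *
        spinCoeff p q i (Real.cos (v 2 / 2) : ℂ) (Real.sin (v 2 / 2) : ℂ))) =
      (p.factorial : ℂ) * (q.factorial : ℂ) * zonal p q v := by
  set z := Complex.exp (Complex.I / 2 * (v 1 - v 3)) with hz
  set w := Complex.exp (-(Complex.I / 2 * (v 1 - v 3))) with hw
  have h := sum_factorial_mul_coeff_mul_coeff ((Real.cos (v 0 / 2) : ℂ) * z)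
    (-(Real.sin (v 0 / 2) : ℂ) * w) ((Real.sin (v 0 / 2) : ℂ) * z) ((Real.cos (v 0 / 2) : ℂ) * w)
    (Real.cos (v 2 / 2) : ℂ) (-(Real.sin (v 2 / 2) : ℂ)) (Real.sin (v 2 / 2) : ℂ)
    (Real.cos (v 2 / 2) : ℂ) p q
  have hB := frame_offDiag_eq v
  rw [← hz, ← hw] at hB
  rw [hB] at h
  have e1 : (Real.sin (v 0 / 2) : ℂ) * z * (Real.sin (v 2 / 2) : ℂ) +
      (Real.cos (v 0 / 2) : ℂ) * w * (Real.cos (v 2 / 2) : ℂ) = frameDiagConj v := by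
    rw [frameDiagConj, ← hz, ← hw]; push_cast; ring
  have e2 : (Real.cos (v 0 / 2) : ℂ) * z * (Real.cos (v 2 / 2) : ℂ) +
      -(Real.sin (v 0 / 2) : ℂ) * w * -(Real.sin (v 2 / 2) : ℂ) = frameDiag v := by
    rw [frameDiag, ← hz, ← hw]; push_cast; ring
  rw [e1, e2] at h
  rw [zonal, ← h]
  refine Finset.sum_congr rfl fun i hi => ?_
  rw [coeff_affine_pow_mul_scale _ _ _ _ _ _ _ _ _ (Nat.lt_succ_iff.1 (Finset.mem_range.1 hi))]
  simp only [spinCoeff]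
  ring

/-- The addition theorem for spin-weighted spherical harmonics. -/
lemma sum_sY_mul_conj {l s : ℤ} {p q : ℕ} (hp : l + s = p) (hq : l - s = q) {x y : ℝ × ℝ}
    (hx : Real.sin (x.1 / 2) ≠ 0) (hy : Real.sin (y.1 / 2) ≠ 0) :
    ∑ m ∈ Finset.Icc (-l) l, sY s l m x * (starRingEnd ℂ) (sY s l m y) =
      ((2 * l + 1) / (4 * Real.pi) : ℝ) * zonal p q ![x.1, x.2, y.1, y.2] := by
  have hI := sum_Icc_add_eq_sum_range
    (fun m => sY s l m x * (starRingEnd ℂ) (sY s l m y)) (-l) (p + q)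
  rw [show -l + ((p + q : ℕ) : ℤ) = l by push_cast; omega] at hI
  rw [hI]
  have hpq : ((p.factorial : ℂ) * (q.factorial : ℂ)) ≠ 0 := by
    exact_mod_cast (Nat.mul_pos p.factorial_pos q.factorial_pos).ne'
  apply mul_left_cancel₀ hpq
  rw [mul_left_comm, ← sum_factorial_mul_spinCoeff, Finset.mul_sum, Finset.mul_sum]
  refine Finset.sum_congr rfl fun i hi => ?_
  have hi' : i ≤ p + q := Nat.lt_succ_iff.1 (Finset.mem_range.1 hi)
  obtain ⟨j, hj⟩ : ∃ j, p + q = i + j := ⟨p + q - i, by omega⟩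
  have hm : l + (-l + (i : ℤ)) = i := by ring
  rw [sY_eq_spinCoeff hp hq hm hx, sY_eq_spinCoeff hp hq hm hy]
  simp only [map_mul, Complex.conj_ofReal, ← Complex.exp_conj, map_zpow₀, map_neg, map_one,
    Complex.conj_I, map_intCast]
  simp only [spinCoeff_ofReal]
  set m : ℤ := -l + i with hmdef
  have hsign : ((-1 : ℂ) ^ (max (-m) 0)) * ((-1 : ℂ) ^ (max (-m) 0)) = 1 := by
    rw [← mul_zpow]; simp
  have hexp : Complex.exp (Complex.I * m * x.2) * Complex.exp (-Complex.I * m * y.2) =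
      Complex.exp (Complex.I / 2 * ((x.2 : ℂ) - y.2)) ^ i *
        Complex.exp (-(Complex.I / 2 * ((x.2 : ℂ) - y.2))) ^ (p + q - i) := by
    rw [← Complex.exp_add, ← Complex.exp_nat_mul, ← Complex.exp_nat_mul, ← Complex.exp_add]
    congr 1
    have hm2 : (2 : ℂ) * (m : ℂ) = i - (p + q - i : ℕ) := by
      have : 2 * m = (i : ℤ) - ((p + q - i : ℕ) : ℤ) := by omega
      exact_mod_cast congrArg (Int.cast (R := ℂ)) this
    linear_combination (Complex.I / 2 * ((x.2 : ℂ) - y.2)) * hm2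
  have hl : (0 : ℝ) ≤ 2 * (l : ℝ) + 1 := by
    have : (0 : ℤ) ≤ 2 * l + 1 := by omega
    exact_mod_cast this
  have halm : (p.factorial : ℂ) * (q.factorial : ℂ) *
      (((alm l m / Real.sqrt (p.factorial * q.factorial) : ℝ) : ℂ) *
      ((alm l m / Real.sqrt (p.factorial * q.factorial) : ℝ) : ℂ)) =
      ((2 * l + 1) / (4 * Real.pi) : ℝ) * ((i.factorial : ℂ) * ((p + q - i).factorial : ℂ)) := by
    have h1 : alm l m * alm l m = (i.factorial : ℝ) * ((p + q - i).factorial : ℝ) *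
        (2 * l + 1) / (4 * Real.pi) := by
      rw [alm, Real.mul_self_sqrt]
      · rw [show (l + m).toNat = i by omega, show (l - m).toNat = p + q - i by omega]
      · positivity
    have h2 : Real.sqrt (p.factorial * q.factorial) * Real.sqrt (p.factorial * q.factorial) =
        p.factorial * q.factorial := Real.mul_self_sqrt (by positivity)
    have h3 : (0 : ℝ) < p.factorial * q.factorial := by positivity
    rw [← Complex.ofReal_mul, div_mul_div_comm, h1, h2]
    have : (p.factorial : ℝ) * q.factorial * ((i.factorial : ℝ) * ((p + q - i).factorial : ℝ) *
        (2 * l + 1) / (4 * Real.pi) / (p.factorial * q.factorial)) =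
        ((2 * l + 1) / (4 * Real.pi)) * ((i.factorial : ℝ) * ((p + q - i).factorial : ℝ)) := by
      field_simp
    exact_mod_cast congrArg (Complex.ofReal) this
  simp only [Matrix.cons_val_zero, Matrix.cons_val_one, Matrix.cons_val]
  rw [← hexp]
  set P := spinCoeff p q i ((Real.cos (x.1 / 2) : ℝ) : ℂ) ((Real.sin (x.1 / 2) : ℝ) : ℂ)
  set Q := spinCoeff p q i ((Real.cos (y.1 / 2) : ℝ) : ℂ) ((Real.sin (y.1 / 2) : ℝ) : ℂ)
  set E := Complex.exp (Complex.I * m * x.2)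
  set E' := Complex.exp (-Complex.I * m * y.2)
  linear_combination (p.factorial : ℂ) * (q.factorial : ℂ) *
      (((alm l m / Real.sqrt (p.factorial * q.factorial) : ℝ) : ℂ) *
      ((alm l m / Real.sqrt (p.factorial * q.factorial) : ℝ) : ℂ)) * E * E' * P * Q * hsign +
      E * E' * P * Q * halm

lemma sum_factorial_mul_spinCoeff_sq (p q : ℕ) (θ : ℝ) :
    ∑ i ∈ Finset.range (p + q + 1), ((i.factorial : ℝ) * ((p + q - i).factorial : ℝ)) *
      spinCoeff p q i (Real.cos θ) (Real.sin θ) ^ 2 = p.factorial * q.factorial := by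
  have h := sum_factorial_mul_coeff_mul_coeff (Real.cos θ) (-Real.sin θ) (Real.sin θ) (Real.cos θ)
    (Real.cos θ) (-Real.sin θ) (Real.sin θ) (Real.cos θ) p q
  have h1 := Real.sin_sq_add_cos_sq θ
  rw [show Real.sin θ * Real.sin θ + Real.cos θ * Real.cos θ = 1 by linear_combination h1,
    show Real.cos θ * Real.cos θ + -Real.sin θ * -Real.sin θ = 1 by linear_combination h1,
    show -((Real.cos θ * Real.sin θ + -Real.sin θ * Real.cos θ) *
      (Real.sin θ * Real.cos θ + Real.cos θ * -Real.sin θ)) = 0 by ring, zonalSum_one_one_zero,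
    mul_one] at h
  rw [← h]
  exact Finset.sum_congr rfl fun i _ => by rw [spinCoeff, sq]

lemma norm_zonal_le_one (p q : ℕ) (v : Fin 4 → ℝ) : ‖zonal p q v‖ ≤ 1 := by
  have hpq : (0 : ℝ) < p.factorial * q.factorial := by positivity
  have h := congrArg norm (sum_factorial_mul_spinCoeff p q v)
  rw [norm_mul, norm_mul, Complex.norm_natCast, Complex.norm_natCast] at h
  have h1 : ∀ r : ℝ, ‖Complex.exp (Complex.I / 2 * r)‖ = 1 := by
    intro r
    rw [show Complex.I / 2 * (r : ℂ) = ((r / 2 : ℝ) : ℂ) * Complex.I by push_cast; ring,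
      Complex.norm_exp_ofReal_mul_I]
  have hz : ‖Complex.exp (Complex.I / 2 * (v 1 - v 3))‖ = 1 := by
    simpa using h1 (v 1 - v 3)
  have hw : ‖Complex.exp (-(Complex.I / 2 * (v 1 - v 3)))‖ = 1 := by
    rw [Complex.exp_neg, norm_inv, hz, inv_one]
  have h2 : ‖∑ i ∈ Finset.range (p + q + 1), ((i.factorial : ℂ) * ((p + q - i).factorial : ℂ)) *
      (Complex.exp (Complex.I / 2 * (v 1 - v 3)) ^ i *
        Complex.exp (-(Complex.I / 2 * (v 1 - v 3))) ^ (p + q - i) *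
        (spinCoeff p q i (Real.cos (v 0 / 2) : ℂ) (Real.sin (v 0 / 2) : ℂ) *
        spinCoeff p q i (Real.cos (v 2 / 2) : ℂ) (Real.sin (v 2 / 2) : ℂ)))‖ ≤
      ∑ i ∈ Finset.range (p + q + 1),
        (((i.factorial : ℝ) * ((p + q - i).factorial : ℝ)) *
          spinCoeff p q i (Real.cos (v 0 / 2)) (Real.sin (v 0 / 2)) ^ 2 / 2 +
        ((i.factorial : ℝ) * ((p + q - i).factorial : ℝ)) *
          spinCoeff p q i (Real.cos (v 2 / 2)) (Real.sin (v 2 / 2)) ^ 2 / 2) := by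
    refine norm_sum_le_of_le _ fun i _ => ?_
    rw [norm_mul, norm_mul, norm_mul, norm_mul, norm_mul, norm_pow, norm_pow, hz, hw, one_pow,
      one_pow, one_mul, one_mul, Complex.norm_natCast, Complex.norm_natCast, ← spinCoeff_ofReal,
      ← spinCoeff_ofReal, Complex.norm_real, Complex.norm_real, Real.norm_eq_abs, Real.norm_eq_abs]
    set P := spinCoeff p q i (Real.cos (v 0 / 2)) (Real.sin (v 0 / 2))
    set Q := spinCoeff p q i (Real.cos (v 2 / 2)) (Real.sin (v 2 / 2))
    have h3 : |P| * |Q| ≤ P ^ 2 / 2 + Q ^ 2 / 2 := by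
      nlinarith [sq_nonneg (|P| - |Q|), sq_abs P, sq_abs Q]
    calc _ ≤ (i.factorial : ℝ) * ((p + q - i).factorial : ℝ) * (P ^ 2 / 2 + Q ^ 2 / 2) := by
          gcongr
      _ = _ := by ring
  rw [Finset.sum_add_distrib, ← Finset.sum_div, ← Finset.sum_div, sum_factorial_mul_spinCoeff_sq,
    sum_factorial_mul_spinCoeff_sq, h] at h2
  refine le_of_mul_le_mul_left ?_ hpq
  linarith

lemma trigMonomial_mem_trigPoly {ι : Type*} [Fintype ι] {n : ℕ} {k : ι → ℤ}
    (hk : ∀ j, |k j| ≤ n) : trigMonomial k ∈ trigPoly ι n :=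
  Submodule.subset_span ⟨k, hk, rfl⟩

lemma exp_half_mem_trigPoly {ι : Type*} [Fintype ι] [DecidableEq ι] (j : ι) :
    (fun v : ι → ℝ => Complex.exp (Complex.I / 2 * v j)) ∈ trigPoly ι 1 ∧
    (fun v : ι → ℝ => Complex.exp (-(Complex.I / 2 * v j))) ∈ trigPoly ι 1 := by
  have h : ∀ e : ℤ, |e| ≤ 1 → (fun v : ι → ℝ => Complex.exp (e * (Complex.I / 2 * v j))) ∈
      trigPoly ι 1 := by
    intro e he
    have : (fun v : ι → ℝ => Complex.exp (e * (Complex.I / 2 * v j))) =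
        trigMonomial (Pi.single j e) := by
      funext v
      rw [trigMonomial, Finset.sum_eq_single j]
      · simp only [Pi.single_eq_same]
        ring_nf
      · intro i _ hi
        simp [Pi.single_eq_of_ne hi]
      · simp
    rw [this]
    refine trigMonomial_mem_trigPoly fun i => ?_
    rcases eq_or_ne i j with rfl | hi
    · simpa using he
    · simp [Pi.single_eq_of_ne hi]
  constructor
  · simpa using h 1 (by simp)
  · simpa using h (-1) (by simp)

lemma cos_half_mem_trigPoly {ι : Type*} [Fintype ι] [DecidableEq ι] (j : ι) :
    (fun v : ι → ℝ => ((Real.cos (v j / 2) : ℝ) : ℂ)) ∈ trigPoly ι 1 := by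
  have h := Submodule.smul_mem _ (1 / 2 : ℂ)
    (add_mem (exp_half_mem_trigPoly (ι := ι) j).1 (exp_half_mem_trigPoly j).2)
  convert h using 1
  funext v
  simp only [Pi.smul_apply, Pi.add_apply, smul_eq_mul, Complex.ofReal_cos, Complex.cos]
  push_cast
  ring_nf

lemma sin_half_mem_trigPoly {ι : Type*} [Fintype ι] [DecidableEq ι] (j : ι) :
    (fun v : ι → ℝ => ((Real.sin (v j / 2) : ℝ) : ℂ)) ∈ trigPoly ι 1 := by
  have h := Submodule.smul_mem _ (Complex.I / 2 : ℂ)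
    (sub_mem (exp_half_mem_trigPoly (ι := ι) j).2 (exp_half_mem_trigPoly j).1)
  convert h using 1
  funext v
  simp only [Pi.smul_apply, Pi.sub_apply, smul_eq_mul, Complex.ofReal_sin, Complex.sin]
  push_cast
  ring_nf

lemma exp_half_sub_mem_trigPoly {ι : Type*} [Fintype ι] [DecidableEq ι] (j k : ι) :
    (fun v : ι → ℝ => Complex.exp (Complex.I / 2 * (v j - v k))) ∈ trigPoly ι 2 ∧
    (fun v : ι → ℝ => Complex.exp (-(Complex.I / 2 * (v j - v k)))) ∈ trigPoly ι 2 := by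
  constructor
  · convert mul_mem_trigPoly (exp_half_mem_trigPoly (ι := ι) j).1 (exp_half_mem_trigPoly k).2
      using 1
    funext v
    rw [Pi.mul_apply, ← Complex.exp_add]
    ring_nf
  · convert mul_mem_trigPoly (exp_half_mem_trigPoly (ι := ι) j).2 (exp_half_mem_trigPoly k).1
      using 1
    funext v
    rw [Pi.mul_apply, ← Complex.exp_add]
    ring_nf

lemma frame_terms_mem_trigPoly :
    (fun v : Fin 4 → ℝ => ((Real.cos (v 0 / 2) * Real.cos (v 2 / 2) : ℝ) : ℂ)) ∈
      trigPoly (Fin 4) 2 ∧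
    (fun v : Fin 4 → ℝ => ((Real.sin (v 0 / 2) * Real.sin (v 2 / 2) : ℝ) : ℂ)) ∈
      trigPoly (Fin 4) 2 := by
  constructor
  · convert mul_mem_trigPoly (cos_half_mem_trigPoly (0 : Fin 4)) (cos_half_mem_trigPoly 2) using 1
    funext v
    simp
  · convert mul_mem_trigPoly (sin_half_mem_trigPoly (0 : Fin 4)) (sin_half_mem_trigPoly 2) using 1
    funext v
    simp

lemma frameDiag_mem_trigPoly : frameDiag ∈ trigPoly (Fin 4) 4 := by
  have h := add_mem (mul_mem_trigPoly frame_terms_mem_trigPoly.1 (exp_half_sub_mem_trigPoly 1 3).1)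
    (mul_mem_trigPoly frame_terms_mem_trigPoly.2 (exp_half_sub_mem_trigPoly 1 3).2)
  refine Eq.subst (motive := fun g => g ∈ trigPoly (Fin 4) (2 + 2)) ?_ h
  funext v
  simp [frameDiag]

lemma frameDiagConj_mem_trigPoly : frameDiagConj ∈ trigPoly (Fin 4) 4 := by
  have h := add_mem (mul_mem_trigPoly frame_terms_mem_trigPoly.2 (exp_half_sub_mem_trigPoly 1 3).1)
    (mul_mem_trigPoly frame_terms_mem_trigPoly.1 (exp_half_sub_mem_trigPoly 1 3).2)
  refine Eq.subst (motive := fun g => g ∈ trigPoly (Fin 4) (2 + 2)) ?_ h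
  funext v
  simp [frameDiagConj]

lemma chordSq_mem_trigPoly : (fun v => (chordSq v : ℂ)) ∈ trigPoly (Fin 4) 8 := by
  have h : _ ∈ trigPoly (Fin 4) (4 + 4) := Submodule.smul_mem _ (2 : ℂ)
    (sub_mem (const_mem_trigPoly (ι := Fin 4) 1 (4 + 4))
      (mul_mem_trigPoly frameDiagConj_mem_trigPoly frameDiag_mem_trigPoly))
  refine Eq.subst (motive := fun g => g ∈ trigPoly (Fin 4) (4 + 4)) ?_ h
  funext v
  simp only [Pi.smul_apply, Pi.sub_apply, Pi.mul_apply, smul_eq_mul]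
  linear_combination -2 * frameDiag_mul v

lemma zonal_mem_trigPoly (p q : ℕ) : zonal p q ∈ trigPoly (Fin 4) (8 * (p + q)) := by
  have h : zonal p q = ∑ k ∈ Finset.range (q + 1), ((p.choose k : ℂ) * (q.choose k : ℂ) *
      (-1 / 2) ^ k) • (frameDiagConj ^ (p - k) * frameDiag ^ (q - k) *
        (fun v => (chordSq v : ℂ)) ^ k) := by
    funext v
    simp only [zonal, zonalSum, Finset.sum_apply, Pi.smul_apply, Pi.mul_apply, Pi.pow_apply,
      smul_eq_mul]
    refine Finset.sum_congr rfl fun k _ => ?_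
    rw [show -((chordSq v : ℂ) / 2) = (-1 / 2) * chordSq v by ring, mul_pow]
    ring
  rw [h]
  refine Submodule.sum_mem _ fun k hk => Submodule.smul_mem _ _ (trigPoly_mono ?_
    (mul_mem_trigPoly (mul_mem_trigPoly (pow_mem_trigPoly frameDiagConj_mem_trigPoly _)
    (pow_mem_trigPoly frameDiag_mem_trigPoly _)) (pow_mem_trigPoly chordSq_mem_trigPoly _)))
  have := Finset.mem_range.1 hk
  omega

end Kernel

/-- Families `φ t x` (`0 < t ≤ T`, `x ≥ x₀`) that are `J` times differentiable in `x` and whose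
`j`-th derivative is `O(x ^ (m - j))` uniformly in `t`. -/
def IsSymbol (T : ℝ) : ℕ → ℝ → ℤ → (ℝ → ℝ → ℂ) → Prop
  | 0, x₀, m, φ => ∃ C, ∀ t, 0 < t → t ≤ T → ∀ x, x₀ ≤ x → ‖φ t x‖ ≤ C * x ^ m
  | J + 1, x₀, m, φ => (∃ C, ∀ t, 0 < t → t ≤ T → ∀ x, x₀ ≤ x → ‖φ t x‖ ≤ C * x ^ m) ∧
      ∃ ψ : ℝ → ℝ → ℂ, (∀ t, 0 < t → t ≤ T → ∀ x, x₀ ≤ x → HasDerivAt (φ t) (ψ t x) x) ∧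
        IsSymbol T J x₀ (m - 1) ψ

namespace IsSymbol

variable {T x₀ : ℝ} {J : ℕ} {m m' : ℤ} {φ ψ : ℝ → ℝ → ℂ}

lemma bound (h : IsSymbol T J x₀ m φ) :
    ∃ C, ∀ t, 0 < t → t ≤ T → ∀ x, x₀ ≤ x → ‖φ t x‖ ≤ C * x ^ m := by
  cases J with
  | zero => exact h
  | succ J => exact h.1

lemma of_succ (h : IsSymbol T (J + 1) x₀ m φ) : IsSymbol T J x₀ m φ := by
  induction J generalizing m φ with
  | zero => exact h.1
  | succ J ih =>
    obtain ⟨hb, ψ, hd, hψ⟩ := h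
    exact ⟨hb, ψ, hd, ih hψ⟩

lemma mono_order (hx₀ : 1 ≤ x₀) (hm : m ≤ m') (h : IsSymbol T J x₀ m φ) :
    IsSymbol T J x₀ m' φ := by
  have key : ∀ {φ : ℝ → ℝ → ℂ} {m m' : ℤ}, m ≤ m' →
      (∃ C, ∀ t, 0 < t → t ≤ T → ∀ x, x₀ ≤ x → ‖φ t x‖ ≤ C * x ^ m) →
      ∃ C, ∀ t, 0 < t → t ≤ T → ∀ x, x₀ ≤ x → ‖φ t x‖ ≤ C * x ^ m' := by
    rintro φ m m' hm ⟨C, hC⟩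
    refine ⟨|C|, fun t h0 h1 x hx => (hC t h0 h1 x hx).trans ?_⟩
    have hx1 : 1 ≤ x := hx₀.trans hx
    exact mul_le_mul (le_abs_self C) (zpow_le_zpow_right₀ hx1 hm) (by positivity) (abs_nonneg C)
  induction J generalizing m m' φ with
  | zero => exact key hm h
  | succ J ih =>
    obtain ⟨hb, ψ, hd, hψ⟩ := h
    exact ⟨key hm hb, ψ, hd, ih (by omega) hψ⟩

lemma neg (h : IsSymbol T J x₀ m φ) : IsSymbol T J x₀ m (fun t x => -φ t x) := by
  induction J generalizing m φ with
  | zero => simpa [IsSymbol] using h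
  | succ J ih =>
    obtain ⟨⟨C, hC⟩, ψ, hd, hψ⟩ := h
    exact ⟨⟨C, by simpa using hC⟩, _, fun t h0 h1 x hx => (hd t h0 h1 x hx).neg, ih hψ⟩

lemma add (h : IsSymbol T J x₀ m φ) (h' : IsSymbol T J x₀ m ψ) :
    IsSymbol T J x₀ m (fun t x => φ t x + ψ t x) := by
  have key : ∀ {φ ψ : ℝ → ℝ → ℂ} {m : ℤ},
      (∃ C, ∀ t, 0 < t → t ≤ T → ∀ x, x₀ ≤ x → ‖φ t x‖ ≤ C * x ^ m) →
      (∃ C, ∀ t, 0 < t → t ≤ T → ∀ x, x₀ ≤ x → ‖ψ t x‖ ≤ C * x ^ m) →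
      ∃ C, ∀ t, 0 < t → t ≤ T → ∀ x, x₀ ≤ x → ‖φ t x + ψ t x‖ ≤ C * x ^ m := by
    rintro φ ψ m ⟨C, hC⟩ ⟨C', hC'⟩
    refine ⟨C + C', fun t h0 h1 x hx => (norm_add_le _ _).trans ?_⟩
    rw [add_mul]
    exact add_le_add (hC t h0 h1 x hx) (hC' t h0 h1 x hx)
  induction J generalizing m φ ψ with
  | zero => exact key h h'
  | succ J ih =>
    obtain ⟨hb, χ, hd, hχ⟩ := h
    obtain ⟨hb', χ', hd', hχ'⟩ := h'
    exact ⟨key hb hb', _, fun t h0 h1 x hx => (hd t h0 h1 x hx).add (hd' t h0 h1 x hx), ih hχ hχ'⟩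

lemma mul (hx₀ : 1 ≤ x₀) (h : IsSymbol T J x₀ m φ) (h' : IsSymbol T J x₀ m' ψ) :
    IsSymbol T J x₀ (m + m') (fun t x => φ t x * ψ t x) := by
  have key : ∀ {φ ψ : ℝ → ℝ → ℂ} {m m' : ℤ},
      (∃ C, ∀ t, 0 < t → t ≤ T → ∀ x, x₀ ≤ x → ‖φ t x‖ ≤ C * x ^ m) →
      (∃ C, ∀ t, 0 < t → t ≤ T → ∀ x, x₀ ≤ x → ‖ψ t x‖ ≤ C * x ^ m') →
      ∃ C, ∀ t, 0 < t → t ≤ T → ∀ x, x₀ ≤ x → ‖φ t x * ψ t x‖ ≤ C * x ^ (m + m') := by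
    rintro φ ψ m m' ⟨C, hC⟩ ⟨C', hC'⟩
    refine ⟨C * C', fun t h0 h1 x hx => ?_⟩
    have hxp : 0 < x := by linarith
    rw [norm_mul, zpow_add₀ hxp.ne', mul_mul_mul_comm]
    exact mul_le_mul (hC t h0 h1 x hx) (hC' t h0 h1 x hx) (norm_nonneg _)
      ((norm_nonneg _).trans (hC t h0 h1 x hx))
  induction J generalizing m m' φ ψ with
  | zero => exact key h h'
  | succ J ih =>
    have hs := h.of_succ
    have hs' := h'.of_succ
    obtain ⟨hb, χ, hd, hχ⟩ := h
    obtain ⟨hb', χ', hd', hχ'⟩ := h'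
    refine ⟨key hb hb', _, fun t h0 h1 x hx => (hd t h0 h1 x hx).mul (hd' t h0 h1 x hx), ?_⟩
    refine add ?_ ?_
    · have := ih hχ hs'
      rwa [show m - 1 + m' = m + m' - 1 by ring] at this
    · have := ih hs hχ'
      rwa [show m + (m' - 1) = m + m' - 1 by ring] at this

lemma zero : IsSymbol T J x₀ m (fun _ _ => 0) := by
  induction J generalizing m with
  | zero => exact ⟨0, by simp⟩
  | succ J ih => exact ⟨⟨0, by simp⟩, _, fun t _ _ x _ => hasDerivAt_const x 0, ih⟩

lemma const {c : ℝ → ℂ} {C : ℝ} (hc : ∀ t, 0 < t → t ≤ T → ‖c t‖ ≤ C) :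
    IsSymbol T J x₀ 0 (fun t _ => c t) := by
  have hb : ∃ C, ∀ t, 0 < t → t ≤ T → ∀ x, x₀ ≤ x → ‖c t‖ ≤ C * x ^ (0 : ℤ) :=
    ⟨C, fun t h0 h1 x _ => by simpa using hc t h0 h1⟩
  cases J with
  | zero => exact hb
  | succ J => exact ⟨hb, _, fun t _ _ x _ => hasDerivAt_const x _, zero⟩

lemma id (hx₀ : 1 ≤ x₀) : IsSymbol T J x₀ 1 (fun _ x => (x : ℂ)) := by
  have hb : ∃ C, ∀ t, 0 < t → t ≤ T → ∀ x, x₀ ≤ x → ‖(x : ℂ)‖ ≤ C * x ^ (1 : ℤ) :=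
    ⟨1, fun t _ _ x hx => by simp [abs_of_pos (show 0 < x by linarith)]⟩
  cases J with
  | zero => exact hb
  | succ J =>
    exact ⟨hb, _, fun t _ _ x _ => (hasDerivAt_id x).ofReal_comp,
      const (C := 1) (by simp)⟩

lemma inv_affine {a b : ℝ} (ha : 0 < a) (hb : 0 ≤ b) (hx₀ : 1 ≤ x₀) :
    IsSymbol T J x₀ (-1) (fun _ x => (((a * x + b)⁻¹ : ℝ) : ℂ)) := by
  have hbd : ∃ C, ∀ t, 0 < t → t ≤ T → ∀ x, x₀ ≤ x →
      ‖(((a * x + b)⁻¹ : ℝ) : ℂ)‖ ≤ C * x ^ (-1 : ℤ) := by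
    refine ⟨a⁻¹, fun t _ _ x hx => ?_⟩
    have hxp : 0 < x := by linarith
    have : 0 < a * x := mul_pos ha hxp
    rw [Complex.norm_real, Real.norm_of_nonneg (by positivity), zpow_neg_one, ← mul_inv]
    exact inv_anti₀ this (by linarith)
  induction J with
  | zero => exact hbd
  | succ J ih =>
    refine ⟨hbd, fun t x => ((-a : ℝ) : ℂ) * ((((a * x + b)⁻¹ : ℝ) : ℂ) * (((a * x + b)⁻¹ : ℝ) : ℂ)),
      fun t _ _ x hx => ?_, ?_⟩
    · have hxp : 0 < x := by linarith
      have h0 : a * x + b ≠ 0 := by positivity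
      have h1 : HasDerivAt (fun x : ℝ => (a * x + b)⁻¹) (-a / (a * x + b) ^ 2) x := by
        have := (((hasDerivAt_id x).const_mul a).add_const b).inv h0
        rw [mul_one] at this
        exact this
      refine h1.ofReal_comp.congr_deriv ?_
      push_cast
      field_simp
    · have := mul hx₀ (const (T := T) (J := J) (x₀ := x₀) (c := fun _ => ((-a : ℝ) : ℂ))
        (C := ‖((-a : ℝ) : ℂ)‖) (fun _ _ _ => le_rfl)) (mul hx₀ ih ih)
      exact this

lemma zpow_le_of_comparable {x y : ℝ} (hx : 0 < x) (h₁ : x / 2 ≤ y) (h₂ : y ≤ 2 * x) (m : ℤ) :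
    y ^ m ≤ 2 ^ |m| * x ^ m := by
  have hy : 0 < y := by linarith
  rcases le_total 0 m with hm | hm
  · rw [abs_of_nonneg hm, ← mul_zpow]
    exact zpow_le_zpow_left₀ hm hy.le h₂
  · rw [abs_of_nonpos hm]
    obtain ⟨k, rfl⟩ : ∃ k : ℤ, m = -k := ⟨-m, by ring⟩
    have hk : 0 ≤ k := by omega
    rw [neg_neg, zpow_neg, zpow_neg, inv_le_iff_one_le_mul₀ (by positivity)]
    have : x ^ k ≤ (2 * y) ^ k := zpow_le_zpow_left₀ hk hx.le (by linarith)
    rw [mul_zpow] at this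
    have hxk : 0 < x ^ k := by positivity
    calc (1 : ℝ) = x ^ k * (x ^ k)⁻¹ := by field_simp
      _ ≤ 2 ^ k * y ^ k * (x ^ k)⁻¹ := by gcongr
      _ = _ := by ring

lemma shift (hx₀ : 1 ≤ x₀) (h : IsSymbol T J x₀ m φ) :
    IsSymbol T J (x₀ + 1) m (fun t x => φ t (x - 1)) := by
  have key : ∀ {φ : ℝ → ℝ → ℂ} {m : ℤ},
      (∃ C, ∀ t, 0 < t → t ≤ T → ∀ x, x₀ ≤ x → ‖φ t x‖ ≤ C * x ^ m) →
      ∃ C, ∀ t, 0 < t → t ≤ T → ∀ x, x₀ + 1 ≤ x → ‖φ t (x - 1)‖ ≤ C * x ^ m := by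
    rintro φ m ⟨C, hC⟩
    refine ⟨|C| * 2 ^ |m|, fun t h0 h1 x hx => (hC t h0 h1 (x - 1) (by linarith)).trans ?_⟩
    have hx1 : 0 < x - 1 := by linarith
    rw [mul_assoc]
    exact mul_le_mul (le_abs_self C)
      (zpow_le_of_comparable (by linarith) (by linarith) (by linarith) m) (by positivity)
      (abs_nonneg C)
  induction J generalizing m φ with
  | zero => exact key h
  | succ J ih =>
    obtain ⟨hb, ψ, hd, hψ⟩ := h
    exact ⟨key hb, _, fun t h0 h1 x hx =>
      HasDerivAt.comp_sub_const x 1 (hd t h0 h1 (x - 1) (by linarith)), ih hψ⟩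

lemma forward_diff (hx₀ : 1 ≤ x₀) (h : IsSymbol T (J + 1) x₀ m φ) :
    IsSymbol T J x₀ (m - 1) (fun t x => φ t (x + 1) - φ t x) := by
  have key : ∀ {φ : ℝ → ℝ → ℂ} {m : ℤ}, IsSymbol T 1 x₀ m φ →
      ∃ C, ∀ t, 0 < t → t ≤ T → ∀ x, x₀ ≤ x →
        ‖φ t (x + 1) - φ t x‖ ≤ C * x ^ (m - 1) := by
    rintro φ m ⟨-, ψ, hd, C, hC⟩
    refine ⟨|C| * 2 ^ |m - 1|, fun t h0 h1 x hx => ?_⟩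
    have := (convex_Icc x (x + 1)).norm_image_sub_le_of_norm_hasDerivWithin_le
      (f := φ t) (f' := ψ t) (C := |C| * 2 ^ |m - 1| * x ^ (m - 1))
      (fun y hy => (hd t h0 h1 y (hx.trans hy.1)).hasDerivWithinAt)
      (fun y hy => (hC t h0 h1 y (hx.trans hy.1)).trans (by
        have hy0 : 0 < y := by linarith [hy.1]
        rw [mul_assoc]
        exact mul_le_mul (le_abs_self C) (zpow_le_of_comparable (by linarith)
          (by linarith [hy.1]) (by linarith [hy.2]) _) (by positivity) (abs_nonneg C)))
      (Set.left_mem_Icc.2 (by linarith)) (Set.right_mem_Icc.2 (by linarith))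
    simpa using this
  have hle : ∀ {J : ℕ} {φ : ℝ → ℝ → ℂ} {m : ℤ}, IsSymbol T (J + 1) x₀ m φ →
      IsSymbol T 1 x₀ m φ := by
    intro J
    induction J with
    | zero => exact fun h => h
    | succ J ih => exact fun h => ih h.of_succ
  induction J generalizing m φ with
  | zero => exact key h
  | succ J ih =>
    have hb := key (hle h)
    obtain ⟨-, ψ, hd, hψ⟩ := h
    exact ⟨hb, _, fun t h0 h1 x hx =>
      ((hd t h0 h1 (x + 1) (by linarith)).comp_add_const x 1).sub (hd t h0 h1 x hx), ih hψ⟩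

end IsSymbol

/-- Multiplication of a spin-`S` zonal expansion by `1 - cos d` acts on its coefficients as a
second-order difference operator; this is its extension to functions of a real variable. -/
def contDiffOp (S : ℝ) (φ : ℝ → ℝ → ℂ) : ℝ → ℝ → ℂ := fun t x =>
  ((((x + 1 : ℝ) : ℂ) - ((S ^ 2 * (x + 1)⁻¹ : ℝ) : ℂ)) * (φ t x - φ t (x + 1)) -
    (((x : ℝ) : ℂ) - ((S ^ 2 * x⁻¹ : ℝ) : ℂ)) * (φ t (x - 1) - φ t x)) *
    (((2 * x + 1)⁻¹ : ℝ) : ℂ)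

lemma IsSymbol.contDiffOp {T x₀ : ℝ} {J : ℕ} {m : ℤ} {φ : ℝ → ℝ → ℂ} (S : ℝ) (hx₀ : 1 ≤ x₀)
    (h : IsSymbol T (J + 2) x₀ m φ) : IsSymbol T J (x₀ + 1) (m - 2) (contDiffOp S φ) := by
  have hx₁ : 1 ≤ x₀ + 1 := by linarith
  have hd : IsSymbol T (J + 1) (x₀ + 1) (m - 1) (fun t x => φ t (x - 1) - φ t x) := by
    have := (h.forward_diff hx₀).shift hx₀ |>.neg
    simpa using this
  have hA : IsSymbol T (J + 1) (x₀ + 1) 1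
      (fun _ x => ((x : ℝ) : ℂ) - ((S ^ 2 * x⁻¹ : ℝ) : ℂ)) := by
    have h1 := IsSymbol.mul hx₁ (IsSymbol.const (T := T) (J := J + 1) (x₀ := x₀ + 1)
      (c := fun _ => ((S ^ 2 : ℝ) : ℂ)) (C := ‖((S ^ 2 : ℝ) : ℂ)‖) (fun _ _ _ => le_rfl))
      (IsSymbol.inv_affine (T := T) (J := J + 1) one_pos le_rfl hx₁)
    have h2 := (IsSymbol.id (T := T) (J := J + 1) hx₁).add
      ((h1.mono_order hx₁ (by norm_num : (0 : ℤ) + -1 ≤ 1)).neg)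
    convert h2 using 3
    simp [sub_eq_add_neg]
  have hB := (IsSymbol.mul hx₁ hA hd).forward_diff hx₁
  have := IsSymbol.mul hx₁ hB (IsSymbol.inv_affine (T := T) (J := J) two_pos zero_le_one hx₁)
  convert this using 1
  · ring
  · funext t x
    simp [_root_.contDiffOp]

lemma IsSymbol.comp_eigenvalue {T x₀ A B κ : ℝ} (J : ℕ) (hx₀ : 1 ≤ x₀) {h : ℝ → ℂ}
    (hh : ContDiff ℝ (⊤ : ℕ∞) h) (hs : ∀ u, h u ≠ 0 → u ∈ Set.Icc A B) :
    IsSymbol T J x₀ 0 (fun t x => h (t ^ 2 * (x ^ 2 + x - κ))) := by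
  have hbd : ∀ {h : ℝ → ℂ}, ContDiff ℝ (⊤ : ℕ∞) h → (∀ u, h u ≠ 0 → u ∈ Set.Icc A B) →
      ∃ C, ∀ t, 0 < t → t ≤ T → ∀ x, x₀ ≤ x →
        ‖h (t ^ 2 * (x ^ 2 + x - κ))‖ ≤ C * x ^ (0 : ℤ) := by
    intro h hh hs
    obtain ⟨C, hC⟩ := isCompact_Icc.exists_bound_of_continuousOn (s := Set.Icc A B)
      hh.continuous.continuousOn
    refine ⟨|C|, fun t _ _ x _ => ?_⟩
    rw [zpow_zero, mul_one]
    by_cases h0 : h (t ^ 2 * (x ^ 2 + x - κ)) = 0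
    · rw [h0, norm_zero]; exact abs_nonneg C
    · exact (hC _ (hs _ h0)).trans (le_abs_self C)
  induction J generalizing h with
  | zero => exact hbd hh hs
  | succ J ih =>
    have hd : ContDiff ℝ (⊤ : ℕ∞) (deriv h) := (contDiff_infty_iff_deriv.1 hh).2
    have hds : ∀ u, deriv h u ≠ 0 → u ∈ Set.Icc A B := by
      intro u hu
      by_contra hcon
      apply hu
      have : h =ᶠ[nhds u] fun _ => 0 := by
        filter_upwards [isClosed_Icc.isOpen_compl.mem_nhds hcon] with v hv
        by_contra h0
        exact hv (hs v h0)
      rw [this.deriv_eq, deriv_const]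
    have hv := ih (h := fun u => (u : ℂ) * deriv h u)
      (Complex.ofRealCLM.contDiff.mul hd) (fun u hu => hds u (right_ne_zero_of_mul hu))
    have ht : IsSymbol T J x₀ 0 (fun t _ => ((t ^ 2 * κ : ℝ) : ℂ)) := by
      refine IsSymbol.const (C := T ^ 2 * |κ|) fun t h0 h1 => ?_
      rw [Complex.norm_real, norm_mul, Real.norm_eq_abs, Real.norm_eq_abs,
        abs_of_nonneg (by positivity)]
      gcongr
    have hsum := hv.add (IsSymbol.mul hx₀ ht (ih hd hds))
    have := IsSymbol.mul hx₀ ((IsSymbol.inv_affine (T := T) (J := J) one_pos le_rfl hx₀).add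
      (IsSymbol.inv_affine one_pos zero_le_one hx₀)) hsum
    refine ⟨hbd hh hs, _, fun t _ _ x hx => ?_, this⟩
    have hx0 : (x : ℂ) ≠ 0 := by
      have : x ≠ 0 := by linarith
      exact_mod_cast this
    have hx1 : (x : ℂ) + 1 ≠ 0 := by
      have : x + 1 ≠ 0 := by linarith
      exact_mod_cast this
    have h1 : HasDerivAt (fun x : ℝ => t ^ 2 * (x ^ 2 + x - κ)) (t ^ 2 * (2 * x + 1)) x := by
      simpa using (((hasDerivAt_pow 2 x).add (hasDerivAt_id x)).sub_const κ).const_mul (t ^ 2)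
    have h2 := ((hh.differentiable (by simp)) (t ^ 2 * (x ^ 2 + x - κ))).hasDerivAt.scomp x h1
    refine h2.congr_deriv ?_
    rw [Complex.real_smul]
    push_cast
    simp only [one_mul, add_zero]
    field_simp
    ring

lemma IsSymbol.iterate_contDiffOp {T A B κ : ℝ} (S : ℝ) (J k : ℕ) {h : ℝ → ℂ}
    (hh : ContDiff ℝ (⊤ : ℕ∞) h) (hs : ∀ u, h u ≠ 0 → u ∈ Set.Icc A B) :
    IsSymbol T J (k + 1) (-(2 * k))
      ((_root_.contDiffOp S)^[k] (fun t x => h (t ^ 2 * (x ^ 2 + x - κ)))) := by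
  induction k generalizing J with
  | zero => simpa using IsSymbol.comp_eigenvalue J (le_refl (1 : ℝ)) hh hs
  | succ k ih =>
    rw [Function.iterate_succ_apply']
    have := IsSymbol.contDiffOp S (by simp) (ih (J + 2))
    push_cast
    convert this using 1
    ring

section DifferenceOperator

/-- The weight `l - S ^ 2 / l` with `l = n + S`. -/
def degreeWeight (S : ℝ) (n : ℕ) : ℝ := (n + S) - S ^ 2 * ((n : ℝ) + S)⁻¹

lemma degreeWeight_zero (S : ℝ) : degreeWeight S 0 = 0 := by
  rcases eq_or_ne S 0 with rfl | h
  · simp [degreeWeight]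
  · simp only [degreeWeight, Nat.cast_zero, zero_add]
    field_simp
    ring

lemma degreeWeight_nonneg {S : ℝ} (hS : 0 ≤ S) (n : ℕ) : 0 ≤ degreeWeight S n := by
  rcases Nat.eq_zero_or_pos n with rfl | hn
  · rw [degreeWeight_zero]
  · have hn' : (0 : ℝ) < n := by exact_mod_cast hn
    rw [degreeWeight, sub_nonneg, ← div_eq_mul_inv, div_le_iff₀ (by positivity)]
    nlinarith

lemma degreeWeight_le {S : ℝ} (hS : 0 ≤ S) (n : ℕ) : degreeWeight S n ≤ n + S := by
  rw [degreeWeight]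
  have : 0 ≤ S ^ 2 * ((n : ℝ) + S)⁻¹ := by positivity
  linarith

/-- The difference operator dual to multiplication by `chordSq`. -/
def seqDiffOp (S : ℝ) (G : ℕ → ℂ) : ℕ → ℂ := fun n =>
  ((degreeWeight S (n + 1) : ℂ) * (G n - G (n + 1)) - (degreeWeight S n : ℂ) * (G (n - 1) - G n)) *
    (((2 * ((n : ℝ) + S) + 1)⁻¹ : ℝ) : ℂ)

lemma seqDiffOp_eq_contDiffOp (S : ℝ) (φ : ℝ → ℝ → ℂ) (t : ℝ) :
    seqDiffOp S (fun n => φ t (n + S)) = fun n : ℕ => contDiffOp S φ t (n + S) := by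
  funext n
  simp only [seqDiffOp, contDiffOp]
  congr 1
  congr 1
  · rw [degreeWeight]
    push_cast
    rw [show (n : ℝ) + 1 + S = n + S + 1 by ring]
    ring
  · rcases Nat.eq_zero_or_pos n with rfl | hn
    · have h := degreeWeight_zero S
      have h' : (((0 : ℕ) : ℝ) + S : ℝ) - S ^ 2 * (((0 : ℕ) : ℝ) + S)⁻¹ = 0 := h
      rw [h, ← Complex.ofReal_sub, h']
      simp
    · rw [degreeWeight, Nat.cast_sub hn]
      push_cast
      rw [show (n : ℝ) - 1 + S = n + S - 1 by ring]

lemma iterate_seqDiffOp_eq (S : ℝ) (φ : ℝ → ℝ → ℂ) (t : ℝ) (k : ℕ) :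
    (seqDiffOp S)^[k] (fun n => φ t (n + S)) =
      fun n : ℕ => (contDiffOp S)^[k] φ t (n + S) := by
  induction k with
  | zero => rfl
  | succ k ih =>
    rw [Function.iterate_succ_apply', ih, Function.iterate_succ_apply', seqDiffOp_eq_contDiffOp]

lemma norm_seqDiffOp_le {S : ℝ} (hS : 0 ≤ S) {G : ℕ → ℂ} {C : ℝ} (hG : ∀ n, ‖G n‖ ≤ C) (n : ℕ) :
    ‖seqDiffOp S G n‖ ≤ 4 * C := by
  have h1 := degreeWeight_le hS (n + 1)
  have h2 := degreeWeight_le hS n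
  have h3 := degreeWeight_nonneg hS (n + 1)
  have h4 := degreeWeight_nonneg hS n
  have hn : (0 : ℝ) ≤ n := n.cast_nonneg
  have hC : 0 ≤ C := (norm_nonneg _).trans (hG 0)
  have h5 : (0 : ℝ) < 2 * ((n : ℝ) + S) + 1 := by positivity
  have hd : ∀ a b, ‖G a - G b‖ ≤ 2 * C := fun a b =>
    (norm_sub_le _ _).trans (by linarith [hG a, hG b])
  rw [seqDiffOp, norm_mul, Complex.norm_real, Real.norm_of_nonneg (inv_nonneg.2 h5.le),
    ← div_eq_mul_inv, div_le_iff₀ h5]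
  refine (norm_sub_le _ _).trans ?_
  rw [norm_mul, norm_mul, Complex.norm_real, Complex.norm_real, Real.norm_of_nonneg h3,
    Real.norm_of_nonneg h4]
  push_cast at h1
  calc _ ≤ (n + 1 + S) * (2 * C) + (n + S) * (2 * C) := by
        gcongr
        · exact hd _ _
        · exact hd _ _
    _ ≤ _ := by nlinarith

lemma norm_iterate_seqDiffOp_le {S : ℝ} (hS : 0 ≤ S) {G : ℕ → ℂ} {C : ℝ} (hG : ∀ n, ‖G n‖ ≤ C)
    (k n : ℕ) : ‖(seqDiffOp S)^[k] G n‖ ≤ 4 ^ k * C := by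
  induction k generalizing n with
  | zero => simpa using hG n
  | succ k ih =>
    rw [Function.iterate_succ_apply']
    exact (norm_seqDiffOp_le hS ih n).trans (by rw [pow_succ]; linarith)

lemma exists_ne_zero_of_iterate_seqDiffOp_ne_zero {S : ℝ} {G : ℕ → ℂ} {k n : ℕ}
    (h : (seqDiffOp S)^[k] G n ≠ 0) : ∃ m, m ≤ n + k ∧ n ≤ m + k ∧ G m ≠ 0 := by
  induction k generalizing n with
  | zero => exact ⟨n, le_rfl, le_rfl, h⟩
  | succ k ih =>
    rw [Function.iterate_succ_apply'] at h
    obtain ⟨j, hj1, hj2, hj⟩ : ∃ j, j ≤ n + 1 ∧ n ≤ j + 1 ∧ (seqDiffOp S)^[k] G j ≠ 0 := by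
      by_contra! hc
      apply h
      rw [seqDiffOp, hc n (by omega) (by omega), hc (n + 1) (by omega) (by omega),
        hc (n - 1) (by omega) (by omega)]
      simp
    obtain ⟨m, h1, h2, h3⟩ := ih hj
    exact ⟨m, by omega, by omega, h3⟩

lemma mul_sum_eq_sum_seqDiffOp {S : ℝ} (hS : 0 ≤ S) {w : ℂ} {D G : ℕ → ℂ} {N : ℕ}
    (hD : ∀ n : ℕ, ((2 * ((n : ℝ) + S) + 1 : ℝ) : ℂ) * (w * D n) =
      degreeWeight S (n + 1) * (D n - D (n + 1)) + degreeWeight S n * (D n - D (n - 1)))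
    (hG : ∀ n, N ≤ n + 1 → G n = 0) :
    w * ∑ n ∈ Finset.range N, ((2 * ((n : ℝ) + S) + 1 : ℝ) : ℂ) * (G n * D n) =
      ∑ n ∈ Finset.range N, ((2 * ((n : ℝ) + S) + 1 : ℝ) : ℂ) * (seqDiffOp S G n * D n) := by
  have h := Finset.sum_range_sub
    (fun n => (degreeWeight S n : ℂ) * (D (n - 1) * G n - G (n - 1) * D n)) N
  rw [hG N (by omega), hG (N - 1) (by omega), degreeWeight_zero] at h
  rw [← sub_eq_zero, Finset.mul_sum, ← Finset.sum_sub_distrib]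
  rw [mul_zero, zero_mul, sub_zero, mul_zero, Complex.ofReal_zero, zero_mul, sub_zero] at h
  rw [← h]
  refine Finset.sum_congr rfl fun n _ => ?_
  have h5 : ((2 * ((n : ℝ) + S) + 1 : ℝ) : ℂ) ≠ 0 := by
    have : (0 : ℝ) < 2 * ((n : ℝ) + S) + 1 := by positivity
    exact_mod_cast this.ne'
  have e : ((2 * ((n : ℝ) + S) + 1 : ℝ) : ℂ) * seqDiffOp S G n =
      (degreeWeight S (n + 1) : ℂ) * (G n - G (n + 1)) -
        (degreeWeight S n : ℂ) * (G (n - 1) - G n) := by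
    rw [seqDiffOp, Complex.ofReal_inv]
    field_simp
  simp only [Nat.add_sub_cancel]
  linear_combination G n * hD n - D n * e

lemma pow_mul_sum_eq_sum_iterate {S : ℝ} (hS : 0 ≤ S) {w : ℂ} {D G : ℕ → ℂ} {N : ℕ} (M : ℕ)
    (hD : ∀ n : ℕ, ((2 * ((n : ℝ) + S) + 1 : ℝ) : ℂ) * (w * D n) =
      degreeWeight S (n + 1) * (D n - D (n + 1)) + degreeWeight S n * (D n - D (n - 1)))
    (hG : ∀ n, N ≤ n + M → G n = 0) :
    w ^ M * ∑ n ∈ Finset.range N, ((2 * ((n : ℝ) + S) + 1 : ℝ) : ℂ) * (G n * D n) =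
      ∑ n ∈ Finset.range N, ((2 * ((n : ℝ) + S) + 1 : ℝ) : ℂ) *
        ((seqDiffOp S)^[M] G n * D n) := by
  induction M with
  | zero => simp
  | succ M ih =>
    rw [pow_succ', mul_assoc, ih fun n hn => hG n (by omega), mul_sum_eq_sum_seqDiffOp hS hD,
      Function.iterate_succ_apply']
    intro n hn
    by_contra h
    obtain ⟨m, h1, h2, h3⟩ := exists_ne_zero_of_iterate_seqDiffOp_ne_zero h
    exact h3 (hG m (by omega))

end DifferenceOperator

section SpinKernel

/-- The zonal kernel of the spin-`s` eigenspace with `l = |s| + n`. -/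
def spinZonal (s : ℤ) (n : ℕ) : (Fin 4 → ℝ) → ℂ :=
  zonal (n + (|s| + s).toNat) (n + (|s| - s).toNat)

lemma spinZonal_recurrence (s : ℤ) (v : Fin 4 → ℝ) (n : ℕ) :
    ((2 * ((n : ℝ) + (s.natAbs : ℝ)) + 1 : ℝ) : ℂ) * (chordSq v * spinZonal s n v) =
      degreeWeight s.natAbs (n + 1) * (spinZonal s n v - spinZonal s (n + 1) v) +
      degreeWeight s.natAbs n * (spinZonal s n v - spinZonal s (n - 1) v) := by
  set p := (|s| + s).toNat with hp
  set q := (|s| - s).toNat with hq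
  set S := s.natAbs with hS
  have habs := Int.natCast_natAbs s
  have hpq : p + q = 2 * S := by omega
  have hpq0 : p * q = 0 := by
    rcases le_total 0 s with h | h
    · have : q = 0 := by omega
      simp [this]
    · have : p = 0 := by omega
      simp [this]
  have hpq' : (p : ℂ) + q = 2 * S := by exact_mod_cast hpq
  have hpq0' : (p : ℂ) * q = 0 := by exact_mod_cast hpq0
  have hw : ∀ m : ℕ, m + S ≠ 0 → ((degreeWeight S m : ℝ) : ℂ) =
      2 * (((m : ℂ) + p) * (m + q) / (2 * m + (p + q))) := by
    intro m hm
    have hm' : (m : ℂ) + S ≠ 0 := by exact_mod_cast hm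
    rw [degreeWeight, hpq', ← mul_add]
    push_cast
    field_simp
    linear_combination -(m : ℂ) * hpq' - hpq0'
  have h := zonal_recurrence (n + p) (n + q) v
  have e1 : 2 * ((((n + p : ℕ) : ℂ) + 1) * (((n + q : ℕ) : ℂ) + 1) /
      (((n + p : ℕ) : ℂ) + ((n + q : ℕ) : ℂ) + 2)) = degreeWeight S (n + 1) := by
    rw [hw (n + 1) (by omega)]
    push_cast
    ring_nf
  rw [e1] at h
  have hz : spinZonal s (n + 1) v = zonal (n + p + 1) (n + q + 1) v := by
    rw [spinZonal, ← hp, ← hq]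
    congr 1 <;> omega
  have e0 : (2 * (((n + p : ℕ) : ℂ) * ((n + q : ℕ) : ℂ) /
      (((n + p : ℕ) : ℂ) + ((n + q : ℕ) : ℂ)))) *
      (zonal (n + p) (n + q) v - zonal (n + p - 1) (n + q - 1) v) =
      degreeWeight S n * (spinZonal s n v - spinZonal s (n - 1) v) := by
    rcases Nat.eq_zero_or_pos n with rfl | hn
    · rw [degreeWeight_zero]
      simp [hpq0']
    · rw [hw n (by omega)]
      have h1 : spinZonal s (n - 1) v = zonal (n + p - 1) (n + q - 1) v := by
        rw [spinZonal, ← hp, ← hq]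
        congr 1 <;> omega
      rw [h1, spinZonal, ← hp, ← hq]
      push_cast
      ring_nf
  rw [e0] at h
  rw [hz, spinZonal, ← hp, ← hq]
  rw [spinZonal, ← hp, ← hq] at h
  rw [← h]
  push_cast
  linear_combination -(chordSq v * zonal (n + p) (n + q) v) * hpq'

lemma lam_cast (s : ℤ) (n : ℕ) : ((lam s (|s| + (n : ℤ)) : ℤ) : ℝ) =
    ((n : ℝ) + s.natAbs) ^ 2 + ((n : ℝ) + s.natAbs) - ((s.natAbs : ℝ) ^ 2 + s.natAbs) := by
  have h1 : lam s (|s| + (n : ℤ)) = ((n : ℤ) + s.natAbs) ^ 2 + ((n : ℤ) + s.natAbs) -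
      ((s.natAbs : ℤ) ^ 2 + s.natAbs) := by
    rw [lam]
    split_ifs with h
    · rw [Int.natCast_natAbs, abs_of_nonneg h]; ring
    · rw [Int.natCast_natAbs, abs_of_neg (not_le.1 h)]; ring
  rw [h1]
  generalize s.natAbs = S
  push_cast
  ring

/-- The coefficients of the kernel of `f (t² Δ_s)`. -/
def kernelCoeff (s : ℤ) (f : ℝ → ℂ) (t : ℝ) (n : ℕ) : ℂ :=
  f (t ^ 2 * ((lam s (|s| + (n : ℤ)) : ℤ) : ℝ))

variable {f : ℝ → ℂ} {A B : ℝ}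

lemma le_of_kernelCoeff_ne_zero (hsupp : ∀ u : ℝ, f u ≠ 0 → u ∈ Set.Icc A B) {s : ℤ} {t : ℝ}
    (ht : 0 < t) {n : ℕ} (h : kernelCoeff s f t n ≠ 0) :
    √(A / (2 * s.natAbs + 1)) ≤ (n + 1) * t ∧ n * t ≤ √B := by
  have h1 := hsupp _ h
  rw [lam_cast, Set.mem_Icc] at h1
  have hS : (0 : ℝ) ≤ (s.natAbs : ℝ) := Nat.cast_nonneg _
  have hn : (0 : ℝ) ≤ (n : ℝ) := Nat.cast_nonneg _
  set S : ℝ := (s.natAbs : ℝ)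
  have ht2 : 0 < t ^ 2 := by positivity
  constructor
  · rw [Real.sqrt_le_left (by positivity), div_le_iff₀ (by positivity)]
    refine h1.1.trans ?_
    rw [mul_pow, mul_right_comm, mul_comm]
    gcongr
    nlinarith [mul_nonneg hn hS, mul_nonneg (mul_nonneg hn hn) hS]
  · refine Real.le_sqrt_of_sq_le (le_trans ?_ h1.2)
    rw [mul_pow, mul_comm]
    gcongr
    nlinarith [mul_nonneg hn hS]

lemma kernelCoeff_eq_zero_of_lt (hA : 0 < A) (hsupp : ∀ u : ℝ, f u ≠ 0 → u ∈ Set.Icc A B) {s : ℤ}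
    {t : ℝ} (ht : √B < t) (n : ℕ) : kernelCoeff s f t n = 0 := by
  by_contra h
  have ht0 : 0 < t := (Real.sqrt_nonneg _).trans_lt ht
  have h1 := (le_of_kernelCoeff_ne_zero hsupp ht0 h).2
  have h2 : n = 0 := by
    by_contra hn
    have : (1 : ℝ) ≤ n := by exact_mod_cast Nat.one_le_iff_ne_zero.2 hn
    nlinarith
  subst h2
  have h3 := hsupp _ h
  rw [lam_cast, Set.mem_Icc] at h3
  have : t ^ 2 * (((0 : ℕ) + (s.natAbs : ℝ)) ^ 2 + ((0 : ℕ) + (s.natAbs : ℝ)) -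
    ((s.natAbs : ℝ) ^ 2 + s.natAbs)) = 0 := by simp
  linarith [h3.1]

/-- The number of relevant terms of the kernel. -/
def cutoff (B t : ℝ) : ℕ := ⌊√B / t⌋₊ + 1

lemma kernelCoeff_eq_zero_of_cutoff_le (hsupp : ∀ u : ℝ, f u ≠ 0 → u ∈ Set.Icc A B) {s : ℤ}
    {t : ℝ} (ht : 0 < t) {n : ℕ} (hn : cutoff B t ≤ n) : kernelCoeff s f t n = 0 := by
  by_contra h
  have h1 := (le_of_kernelCoeff_ne_zero hsupp ht h).2
  rw [← le_div_iff₀ ht] at h1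
  have := Nat.le_floor h1
  rw [cutoff] at hn
  omega

lemma cutoff_le {t : ℝ} (ht : 0 < t) (htB : t ≤ √B) : (cutoff B t : ℝ) ≤ 2 * √B / t := by
  have h1 : 1 ≤ √B / t := by rwa [one_le_div ht]
  have h2 := Nat.floor_le (show 0 ≤ √B / t by positivity)
  rw [cutoff]
  push_cast
  rw [mul_div_assoc]
  linarith

lemma exists_norm_iterate_kernelCoeff_le (hf : ContDiff ℝ (⊤ : ℕ∞) f)
    (hsupp : ∀ u : ℝ, f u ≠ 0 → u ∈ Set.Icc A B) (s : ℤ) (T : ℝ) (M : ℕ) :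
    ∃ C, 0 ≤ C ∧ ∀ t, 0 < t → t ≤ T → ∀ n : ℕ,
      ‖(seqDiffOp s.natAbs)^[M] (kernelCoeff s f t) n‖ * ((n : ℝ) + 1) ^ (2 * M) ≤ C := by
  obtain ⟨C₀, hC₀⟩ : ∃ C, ∀ u, ‖f u‖ ≤ C := by
    obtain ⟨C, hC⟩ := (isCompact_Icc (a := A) (b := B)).exists_bound_of_continuousOn
      hf.continuous.continuousOn
    refine ⟨max C 0, fun u => ?_⟩
    by_cases hu : f u = 0
    · simp [hu]
    · exact (hC u (hsupp u hu)).trans (le_max_left _ _)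
  have hC₀0 : 0 ≤ C₀ := (norm_nonneg _).trans (hC₀ 0)
  set S : ℝ := (s.natAbs : ℝ) with hSdef
  have hS : 0 ≤ S := Nat.cast_nonneg _
  obtain ⟨C₁, hC₁⟩ := (IsSymbol.iterate_contDiffOp (T := T) (κ := S ^ 2 + S) S 0 M hf hsupp).bound
  refine ⟨4 ^ M * C₀ * ((M : ℝ) + 1) ^ (2 * M) + |C₁| * 2 ^ (2 * M), by positivity, ?_⟩
  intro t ht htT n
  have hn : (0 : ℝ) ≤ n := n.cast_nonneg
  rcases le_or_gt ((M : ℝ) + 1) (n + S) with h | h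
  · have e : kernelCoeff s f t = fun n : ℕ =>
        (fun t x => f (t ^ 2 * (x ^ 2 + x - (S ^ 2 + S)))) t ((n : ℝ) + S) := by
      funext n
      rw [kernelCoeff, lam_cast]
    have e' : (seqDiffOp S)^[M] (kernelCoeff s f t) n = (contDiffOp S)^[M]
        (fun t x => f (t ^ 2 * (x ^ 2 + x - (S ^ 2 + S)))) t ((n : ℝ) + S) := by
      rw [e]
      exact congrFun (iterate_seqDiffOp_eq S
        (fun t x => f (t ^ 2 * (x ^ 2 + x - (S ^ 2 + S)))) t M) n
    rw [e']
    have h1 := hC₁ t ht htT _ h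
    have hpos : 0 < (n : ℝ) + S := by
      have : (0 : ℝ) ≤ M := M.cast_nonneg
      linarith
    have hM0 : (0 : ℝ) ≤ M := M.cast_nonneg
    have h2 : ((n : ℝ) + 1) ^ (2 * M) ≤ (2 * (n + S)) ^ (2 * M) := by
      gcongr
      linarith
    have h3 : ((n : ℝ) + S) ^ (-(2 * (M : ℤ))) * (2 * (n + S)) ^ (2 * M) = 2 ^ (2 * M) := by
      rw [zpow_neg, mul_pow, show 2 * (M : ℤ) = ((2 * M : ℕ) : ℤ) by push_cast; ring, zpow_natCast]
      field_simp
    calc _ ≤ (|C₁| * ((n : ℝ) + S) ^ (-(2 * (M : ℤ)))) * (2 * (n + S)) ^ (2 * M) := by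
          refine mul_le_mul (h1.trans ?_) h2 (by positivity) (by positivity)
          gcongr
          exact le_abs_self _
      _ = |C₁| * 2 ^ (2 * M) := by rw [mul_assoc, h3]
      _ ≤ _ := le_add_of_nonneg_left (by positivity)
  · have h1 := norm_iterate_seqDiffOp_le hS (G := kernelCoeff s f t) (fun n => hC₀ _) M n
    calc _ ≤ (4 ^ M * C₀) * ((M : ℝ) + 1) ^ (2 * M) := by
          refine mul_le_mul h1 ?_ (by positivity) (by positivity)
          gcongr
          have : (n : ℝ) < (M : ℝ) + 1 := by linarith
          have : n < M + 1 := by exact_mod_cast this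
          exact_mod_cast (by omega : n ≤ M)
      _ ≤ _ := le_add_of_nonneg_right (by positivity)

/-- The kernel of `f (t² Δ_s)`, extended to all `v = (θ, φ, θ', φ')`. -/
def spinKernel (s : ℤ) (f : ℝ → ℂ) (B t : ℝ) : (Fin 4 → ℝ) → ℂ :=
  ∑ n ∈ Finset.range (cutoff B t), (kernelCoeff s f t n *
    ((2 * ((n : ℝ) + s.natAbs) + 1) / (4 * Real.pi) : ℝ)) • spinZonal s n

lemma spinKernel_mem_trigPoly (s : ℤ) (f : ℝ → ℂ) (B t : ℝ) :
    spinKernel s f B t ∈ trigPoly (Fin 4) (16 * (cutoff B t + s.natAbs)) := by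
  refine Submodule.sum_mem _ fun n hn => Submodule.smul_mem _ _ ?_
  refine trigPoly_mono ?_ (zonal_mem_trigPoly _ _)
  have := Finset.mem_range.1 hn
  have habs := Int.natCast_natAbs s
  omega

lemma exists_chordSq_pow_mul_norm_spinKernel_le (hA : 0 < A) (hf : ContDiff ℝ (⊤ : ℕ∞) f)
    (hsupp : ∀ u : ℝ, f u ≠ 0 → u ∈ Set.Icc A B) (s : ℤ) (M : ℕ) :
    ∃ C, 0 ≤ C ∧ ∀ t, 0 < t → t ≤ √B → ∀ v,
      |chordSq v| ^ M * ‖spinKernel s f B t v‖ * t ^ 2 ≤ C * t ^ (2 * M) := by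
  obtain ⟨C, hC0, hC⟩ := exists_norm_iterate_kernelCoeff_le hf hsupp s (√B) M
  set S : ℝ := (s.natAbs : ℝ) with hSdef
  have hS : 0 ≤ S := Nat.cast_nonneg _
  set a : ℝ := √(A / (2 * S + 1)) with ha
  have ha0 : 0 < a := Real.sqrt_pos.2 (by positivity)
  set b : ℝ := √B
  set R : ℝ := (M + 2 + 2 * S + 1) * b
  refine ⟨(M + 2) * b * (2 * R * (C * ((M + 1) / a) ^ (2 * M))), ?_, ?_⟩
  · have : 0 ≤ b := Real.sqrt_nonneg _
    positivity
  intro t ht htb v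
  have hb : 0 < b := ht.trans_le htb
  set N := cutoff B t + M with hN
  set G := kernelCoeff s f t with hG
  have hNt : (N : ℝ) * t ≤ (M + 2) * b := by
    have h1 := cutoff_le ht htb
    rw [le_div_iff₀ ht] at h1
    rw [hN]
    push_cast
    have hM : (0 : ℝ) ≤ M := M.cast_nonneg
    nlinarith
  have hsum : spinKernel s f B t v = (1 / (4 * Real.pi) : ℝ) *
      ∑ n ∈ Finset.range N, ((2 * ((n : ℝ) + S) + 1 : ℝ) : ℂ) * (G n * spinZonal s n v) := by
    rw [Finset.mul_sum, ← Finset.sum_subset (Finset.range_mono (Nat.le_add_right (cutoff B t) M)),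
      spinKernel, Finset.sum_apply]
    · refine Finset.sum_congr rfl fun n _ => ?_
      simp only [Pi.smul_apply, smul_eq_mul, ← hSdef, ← hG]
      push_cast
      ring
    · intro n _ hn
      rw [hG, kernelCoeff_eq_zero_of_cutoff_le hsupp ht (by simpa using hn)]
      simp
  have hpow := pow_mul_sum_eq_sum_iterate hS (w := (chordSq v : ℂ)) (G := G) (N := N) M
    (spinZonal_recurrence s v)
    (fun n hn => kernelCoeff_eq_zero_of_cutoff_le hsupp ht (by omega))
  have hterm : ∀ n ∈ Finset.range N, ‖((2 * ((n : ℝ) + S) + 1 : ℝ) : ℂ) *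
      ((seqDiffOp S)^[M] G n * spinZonal s n v)‖ ≤
      (2 * R / t) * (C * ((M + 1) / a * t) ^ (2 * M)) := by
    intro n hn
    have hnN : (n : ℝ) + 1 ≤ N := by exact_mod_cast Finset.mem_range.1 hn
    rw [norm_mul, norm_mul, Complex.norm_real]
    have hn0 : (0 : ℝ) ≤ n := n.cast_nonneg
    rw [Real.norm_of_nonneg (by positivity)]
    by_cases h0 : (seqDiffOp S)^[M] G n = 0
    · rw [h0, norm_zero, zero_mul, mul_zero]
      positivity
    obtain ⟨m, hm1, hm2, hm⟩ := exists_ne_zero_of_iterate_seqDiffOp_ne_zero h0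
    have h1 := (le_of_kernelCoeff_ne_zero hsupp ht hm).1
    rw [← ha] at h1
    have hm1' : (m : ℝ) ≤ n + M := by exact_mod_cast hm1
    have hM0 : (0 : ℝ) ≤ M := M.cast_nonneg
    have h2 : 1 ≤ (M + 1) / a * t * (n + 1) := by
      rw [div_mul_eq_mul_div, div_mul_eq_mul_div, one_le_div ha0]
      refine h1.trans ?_
      have : (m : ℝ) + 1 ≤ (M + 1) * (n + 1) := by nlinarith
      nlinarith
    have h3 : ‖(seqDiffOp S)^[M] G n‖ ≤ C * ((M + 1) / a * t) ^ (2 * M) := by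
      calc ‖(seqDiffOp S)^[M] G n‖
          ≤ ‖(seqDiffOp S)^[M] G n‖ * ((M + 1) / a * t * (n + 1)) ^ (2 * M) :=
            le_mul_of_one_le_right (norm_nonneg _) (one_le_pow₀ h2)
        _ = ‖(seqDiffOp S)^[M] G n‖ * ((n : ℝ) + 1) ^ (2 * M) * ((M + 1) / a * t) ^ (2 * M) := by
            rw [mul_pow]; ring
        _ ≤ _ := by gcongr; exact hC t ht htb n
    have h4 : 2 * ((n : ℝ) + S) + 1 ≤ 2 * R / t := by
      rw [le_div_iff₀ ht]
      nlinarith [mul_le_mul_of_nonneg_left htb hS, mul_le_mul_of_nonneg_right hnN ht.le,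
        mul_nonneg hS hb.le]
    have h5 : ‖spinZonal s n v‖ ≤ 1 := norm_zonal_le_one _ _ v
    calc _ ≤ (2 * R / t) * ((C * ((M + 1) / a * t) ^ (2 * M)) * 1) := by gcongr
      _ = _ := by rw [mul_one]
  have hpi : (1 / (4 * Real.pi) : ℝ) ≤ 1 := by
    rw [div_le_one (by positivity)]
    linarith [Real.pi_gt_three]
  have hpi0 : (0 : ℝ) ≤ 1 / (4 * Real.pi) := by positivity
  have h6 : |chordSq v| ^ M * ‖spinKernel s f B t v‖ ≤
      N * ((2 * R / t) * (C * ((M + 1) / a * t) ^ (2 * M))) := by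
    have e : |chordSq v| ^ M * ‖spinKernel s f B t v‖ = (1 / (4 * Real.pi)) *
        ‖∑ n ∈ Finset.range N, ((2 * ((n : ℝ) + S) + 1 : ℝ) : ℂ) *
        ((seqDiffOp S)^[M] G n * spinZonal s n v)‖ := by
      rw [← hpow, hsum, norm_mul, norm_mul, norm_pow, Complex.norm_real, Complex.norm_real,
        Real.norm_of_nonneg hpi0, Real.norm_eq_abs]
      ring
    rw [e]
    calc _ ≤ 1 * (N * ((2 * R / t) * (C * ((M + 1) / a * t) ^ (2 * M)))) := by
          refine mul_le_mul hpi ?_ (norm_nonneg _) zero_le_one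
          refine (norm_sum_le_of_le _ hterm).trans ?_
          rw [Finset.sum_const, Finset.card_range, nsmul_eq_mul]
      _ = _ := one_mul _
  calc _ ≤ N * ((2 * R / t) * (C * ((M + 1) / a * t) ^ (2 * M))) * t ^ 2 := by gcongr
    _ = (N * t) * (2 * R * (C * ((M + 1) / a * t) ^ (2 * M))) := by field_simp
    _ ≤ ((M + 2) * b) * (2 * R * (C * ((M + 1) / a * t) ^ (2 * M))) := by gcongr
    _ = _ := by rw [mul_pow]; ring

end SpinKernel

section Chord

lemma chord_frame_identity (a φ b ψ : ℝ) :
    (Real.sin a * Real.sin b * Real.cos (φ - ψ) + Real.cos a * Real.cos b) ^ 2 +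
      (Real.cos a * Real.sin b * Real.cos (φ - ψ) - Real.sin a * Real.cos b) ^ 2 + (Real.sin b * Real.sin (φ - ψ)) ^ 2 = 1 := by
  have h1 := Real.sin_sq_add_cos_sq a
  have h2 := Real.sin_sq_add_cos_sq b
  have h3 := Real.sin_sq_add_cos_sq (φ - ψ)
  linear_combination (Real.sin b ^ 2 * Real.cos (φ - ψ) ^ 2 + Real.cos b ^ 2) * h1 + h2 + Real.sin b ^ 2 * h3

lemma chordSq_nonneg_and_le (v : Fin 4 → ℝ) : 0 ≤ chordSq v ∧ chordSq v ≤ 2 := by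
  have h := chord_frame_identity (v 0) (v 1) (v 2) (v 3)
  rw [chordSq]
  constructor <;>
  nlinarith [sq_nonneg (Real.cos (v 0) * Real.sin (v 2) * Real.cos (v 1 - v 3) -
    Real.sin (v 0) * Real.cos (v 2)), sq_nonneg (Real.sin (v 2) * Real.sin (v 1 - v 3))]

lemma hasDerivAt_chordSq_update (i : Fin 4) (v : Fin 4 → ℝ) :
    ∃ w' : ℝ, HasDerivAt (fun r => chordSq (Function.update v i r)) w' (v i) ∧
      w' ^ 2 ≤ 2 * chordSq v := by
  have key : ∀ x y z : ℝ, x ^ 2 + y ^ 2 + z ^ 2 = 1 →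
      y ^ 2 ≤ 2 * (1 - x) ∧ z ^ 2 ≤ 2 * (1 - x) := by
    intro x y z h
    constructor <;> nlinarith [sq_nonneg (1 - x), sq_nonneg y, sq_nonneg z]
  have hx := key _ _ _ (chord_frame_identity (v 0) (v 1) (v 2) (v 3))
  have hy := key _ _ _ (chord_frame_identity (v 2) (v 3) (v 0) (v 1))
  have hcos : Real.cos (v 3 - v 1) = Real.cos (v 1 - v 3) := by rw [← Real.cos_neg, neg_sub]
  have hsin : Real.sin (v 3 - v 1) ^ 2 = Real.sin (v 1 - v 3) ^ 2 := by
    rw [← neg_sub, Real.sin_neg, neg_sq]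
  rw [hcos] at hy
  match i with
  | 0 =>
    refine ⟨-(Real.cos (v 0) * Real.sin (v 2) * Real.cos (v 1 - v 3) +
      (-Real.sin (v 0)) * Real.cos (v 2)), ?_, ?_⟩
    · have h := ((((Real.hasDerivAt_sin (v 0)).mul_const (Real.sin (v 2))).mul_const
        (Real.cos (v 1 - v 3))).add
        ((Real.hasDerivAt_cos (v 0)).mul_const (Real.cos (v 2)))).const_sub 1
      simpa [chordSq] using h
    · rw [chordSq]
      linarith [hx.1]
  | 1 =>
    refine ⟨-(Real.sin (v 0) * Real.sin (v 2) * (-Real.sin (v 1 - v 3) * 1)), ?_, ?_⟩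
    · have h := ((((hasDerivAt_id (v 1)).sub_const (v 3)).cos.const_mul
        (Real.sin (v 0) * Real.sin (v 2))).add_const (Real.cos (v 0) * Real.cos (v 2))).const_sub 1
      simpa [chordSq] using h
    · rw [chordSq]
      nlinarith [hx.2, mul_le_mul_of_nonneg_right (Real.sin_sq_le_one (v 0))
        (sq_nonneg (Real.sin (v 2) * Real.sin (v 1 - v 3)))]
  | 2 =>
    refine ⟨-(Real.sin (v 0) * Real.cos (v 2) * Real.cos (v 1 - v 3) +
      Real.cos (v 0) * (-Real.sin (v 2))), ?_, ?_⟩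
    · have h := ((((Real.hasDerivAt_sin (v 2)).const_mul (Real.sin (v 0))).mul_const
        (Real.cos (v 1 - v 3))).add
        ((Real.hasDerivAt_cos (v 2)).const_mul (Real.cos (v 0)))).const_sub 1
      simpa [chordSq] using h
    · rw [chordSq]
      linarith [hy.1]
  | 3 =>
    refine ⟨-(Real.sin (v 0) * Real.sin (v 2) * (-Real.sin (v 1 - v 3) * (-1))), ?_, ?_⟩
    · have h := ((((hasDerivAt_id (v 3)).const_sub (v 1)).cos.const_mul
        (Real.sin (v 0) * Real.sin (v 2))).add_const (Real.cos (v 0) * Real.cos (v 2))).const_sub 1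
      simpa [chordSq] using h
    · rw [chordSq]
      nlinarith [hx.2, mul_le_mul_of_nonneg_right (Real.sin_sq_le_one (v 0))
        (sq_nonneg (Real.sin (v 2) * Real.sin (v 1 - v 3)))]

lemma gd_sq_le (x y : ℝ × ℝ) :
    gd (sphCoords x.1 x.2) (sphCoords y.1 y.2) ^ 2 ≤ 5 * chordSq ![x.1, x.2, y.1, y.2] := by
  have hw := chordSq_nonneg_and_le ![x.1, x.2, y.1, y.2]
  set w := chordSq ![x.1, x.2, y.1, y.2] with hwdef
  have hdot : dot3 (sphCoords x.1 x.2) (sphCoords y.1 y.2) = 1 - w := by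
    simp only [dot3, sphCoords, hwdef, chordSq, Real.cos_sub, Matrix.cons_val_zero,
      Matrix.cons_val_one, Matrix.cons_val]
    ring
  rw [gd, hdot]
  have h1 := Real.cos_le_one_sub_mul_cos_sq (x := Real.arccos (1 - w))
    (by rw [abs_of_nonneg (Real.arccos_nonneg _)]; exact Real.arccos_le_pi _)
  rw [Real.cos_arccos (by linarith) (by linarith)] at h1
  have hpi : Real.pi ^ 2 ≤ 10 := by
    have := Real.pi_lt_d2
    nlinarith [Real.pi_pos]
  have h2 : 2 / Real.pi ^ 2 * Real.arccos (1 - w) ^ 2 ≤ w := by linarith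
  rw [div_mul_eq_mul_div, div_le_iff₀ (by positivity)] at h2
  nlinarith [hw.1]

end Chord

section Localization

/-- Families of trigonometric polynomials of degree `O(1 / t)` that are `O(t ^ (-2 - k))` and decay
rapidly in `chordSq / t ^ 2`, uniformly for `0 < t ≤ b`. -/
def IsLocalized (b : ℝ) (k : ℕ) (g : ℝ → (Fin 4 → ℝ) → ℂ) : Prop :=
  (∃ C, ∀ t, 0 < t → t ≤ b → ∃ n : ℕ, 0 < n ∧ n * t ≤ C ∧ g t ∈ trigPoly (Fin 4) n) ∧
  ∀ M : ℕ, ∃ C, 0 ≤ C ∧ ∀ t, 0 < t → t ≤ b → ∀ v,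
    chordSq v ^ M * ‖g t v‖ * t ^ (2 + k) ≤ C * t ^ (2 * M)

lemma isLocalized_spinKernel {f : ℝ → ℂ} {A B : ℝ} (hA : 0 < A) (hf : ContDiff ℝ (⊤ : ℕ∞) f)
    (hsupp : ∀ u : ℝ, f u ≠ 0 → u ∈ Set.Icc A B) (s : ℤ) :
    IsLocalized (√B) 0 (spinKernel s f B) := by
  constructor
  · refine ⟨16 * (2 * √B + s.natAbs * √B), fun t ht htB =>
      ⟨16 * (cutoff B t + s.natAbs), by simp [cutoff], ?_, spinKernel_mem_trigPoly s f B t⟩⟩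
    have h1 := cutoff_le ht htB
    rw [le_div_iff₀ ht] at h1
    have hS : (0 : ℝ) ≤ (s.natAbs : ℝ) := Nat.cast_nonneg _
    generalize s.natAbs = S at *
    push_cast
    nlinarith [mul_le_mul_of_nonneg_left htB hS]
  · intro M
    obtain ⟨C, hC0, hC⟩ := exists_chordSq_pow_mul_norm_spinKernel_le hA hf hsupp s M
    refine ⟨C, hC0, fun t ht htB v => ?_⟩
    have := hC t ht htB v
    rwa [abs_of_nonneg (chordSq_nonneg_and_le v).1] at this

lemma norm_partialDeriv_chordSq_sq_le (i : Fin 4) (v : Fin 4 → ℝ) :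
    HasDerivAt (fun r => (chordSq (Function.update v i r) : ℂ))
      (partialDeriv i (fun v => (chordSq v : ℂ)) v) (v i) ∧
    ‖partialDeriv i (fun v => (chordSq v : ℂ)) v‖ ^ 2 ≤ 2 * chordSq v := by
  obtain ⟨w', h, hw⟩ := hasDerivAt_chordSq_update i v
  have e : partialDeriv i (fun v => (chordSq v : ℂ)) v = w' := h.ofReal_comp.deriv
  rw [e]
  refine ⟨h.ofReal_comp, ?_⟩
  rwa [Complex.norm_real, Real.norm_eq_abs, sq_abs]

lemma IsLocalized.partialDeriv {b : ℝ} {k : ℕ} {g : ℝ → (Fin 4 → ℝ) → ℂ} (h : IsLocalized b k g)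
    (i : Fin 4) : IsLocalized b (k + 1) (fun t => _root_.partialDeriv i (g t)) := by
  obtain ⟨⟨C, hC⟩, hM⟩ := h
  refine ⟨⟨C, fun t ht htb => ?_⟩, fun M => ?_⟩
  · obtain ⟨n, hn, hnt, hg⟩ := hC t ht htb
    exact ⟨n, hn, hnt, partialDeriv_mem_trigPoly i hg⟩
  obtain ⟨C₁, hC₁0, hC₁⟩ := hM M
  obtain ⟨C₂, hC₂0, hC₂⟩ := hM (M - 1)
  refine ⟨2 * (|C| + 8 * M * |b|) * C₁ + M * (C₂ + C₁), by positivity, fun t ht htb v => ?_⟩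
  obtain ⟨n, hn, hnt, hg⟩ := hC t ht htb
  have hw := fun v => (chordSq_nonneg_and_le v).1
  set W : (Fin 4 → ℝ) → ℂ := fun v => (chordSq v : ℂ) with hW
  have hWM : W ^ M ∈ trigPoly (Fin 4) (M * 8) := pow_mem_trigPoly chordSq_mem_trigPoly M
  have hprod := mul_mem_trigPoly hWM hg
  have hbd : ∀ v, ‖(W ^ M * g t) v‖ ≤ C₁ * t ^ (2 * M) / t ^ (2 + k) := by
    intro v
    rw [le_div_iff₀ (by positivity)]
    refine le_trans (le_of_eq ?_) (hC₁ t ht htb v)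
    rw [Pi.mul_apply, Pi.pow_apply, norm_mul, norm_pow, hW, Complex.norm_real,
      Real.norm_of_nonneg (hw v)]
  have hB := norm_partialDeriv_le i (by omega) hprod hbd v
  obtain ⟨hWd, hWn⟩ := norm_partialDeriv_chordSq_sq_le i v
  rw [← hW] at hWd hWn
  set W' := _root_.partialDeriv i W v
  have hgd := hasDerivAt_partialDeriv i hg v
  set g' := _root_.partialDeriv i (g t) v
  have hpd : _root_.partialDeriv i (W ^ M * g t) v =
      M * W v ^ (M - 1) * W' * g t v + W v ^ M * g' := by
    have h1 := ((hWd.pow M).mul hgd).deriv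
    simp only [Pi.pow_apply, Function.update_eq_self] at h1
    exact h1
  have hg' : W v ^ M * g' = _root_.partialDeriv i (W ^ M * g t) v -
      M * W v ^ (M - 1) * W' * g t v := by rw [hpd]; ring
  have hnorm : chordSq v ^ M * ‖g'‖ ≤ 2 * (M * 8 + n : ℕ) * (C₁ * t ^ (2 * M) / t ^ (2 + k)) +
      M * chordSq v ^ (M - 1) * ‖W'‖ * ‖g t v‖ := by
    have e : chordSq v ^ M * ‖g'‖ = ‖W v ^ M * g'‖ := by
      rw [norm_mul, norm_pow, hW, Complex.norm_real, Real.norm_of_nonneg (hw v)]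
    rw [e, hg']
    refine (norm_sub_le _ _).trans (add_le_add hB (le_of_eq ?_))
    rw [norm_mul, norm_mul, norm_mul, norm_pow, hW, Complex.norm_real,
      Real.norm_of_nonneg (hw v), Complex.norm_natCast]
  have hpart : M * chordSq v ^ (M - 1) * ‖W'‖ * ‖g t v‖ * t ^ (2 + k + 1) ≤
      M * (C₂ + C₁) * t ^ (2 * M) := by
    rcases Nat.eq_zero_or_pos M with rfl | hMpos
    · simp
    obtain ⟨m, rfl⟩ : ∃ m, M = m + 1 := ⟨M - 1, by omega⟩
    simp only [Nat.add_sub_cancel] at *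
    have h1 : t * ‖W'‖ ≤ t ^ 2 + chordSq v := by nlinarith [sq_nonneg (t - ‖W'‖)]
    have h2 := hC₂ t ht htb v
    have h3 := hC₁ t ht htb v
    have hwm : 0 ≤ chordSq v ^ m := pow_nonneg (hw v) m
    calc ((m + 1 : ℕ) : ℝ) * chordSq v ^ m * ‖W'‖ * ‖g t v‖ * t ^ (2 + k + 1)
        = ((m + 1 : ℕ) : ℝ) * (chordSq v ^ m * ‖g t v‖ * t ^ (2 + k)) * (t * ‖W'‖) := by ring
      _ ≤ ((m + 1 : ℕ) : ℝ) * (chordSq v ^ m * ‖g t v‖ * t ^ (2 + k)) * (t ^ 2 + chordSq v) := by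
          gcongr
      _ = ((m + 1 : ℕ) : ℝ) * (t ^ 2 * (chordSq v ^ m * ‖g t v‖ * t ^ (2 + k)) +
          chordSq v ^ (m + 1) * ‖g t v‖ * t ^ (2 + k)) := by ring
      _ ≤ ((m + 1 : ℕ) : ℝ) * (t ^ 2 * (C₂ * t ^ (2 * m)) + C₁ * t ^ (2 * (m + 1))) := by
          gcongr
      _ = _ := by ring
  have hn' : ((M * 8 + n : ℕ) : ℝ) * t ≤ |C| + 8 * M * |b| := by
    push_cast
    have h1 := le_abs_self C
    have h2 : (M : ℝ) * t ≤ M * |b| :=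
      mul_le_mul_of_nonneg_left (htb.trans (le_abs_self b)) M.cast_nonneg
    linarith
  calc chordSq v ^ M * ‖g'‖ * t ^ (2 + (k + 1))
      ≤ (2 * (M * 8 + n : ℕ) * (C₁ * t ^ (2 * M) / t ^ (2 + k)) +
      M * chordSq v ^ (M - 1) * ‖W'‖ * ‖g t v‖) * t ^ (2 + k + 1) := by
        rw [← add_assoc]
        gcongr
    _ = 2 * ((M * 8 + n : ℕ) * t) * C₁ * t ^ (2 * M) +
      M * chordSq v ^ (M - 1) * ‖W'‖ * ‖g t v‖ * t ^ (2 + k + 1) := by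
        rw [add_mul, pow_succ t (2 + k)]
        field_simp
    _ ≤ 2 * (|C| + 8 * M * |b|) * C₁ * t ^ (2 * M) + M * (C₂ + C₁) * t ^ (2 * M) := by
        gcongr
    _ = _ := by ring

lemma IsLocalized.iterate_partialDeriv {b : ℝ} {k : ℕ} {g : ℝ → (Fin 4 → ℝ) → ℂ}
    (h : IsLocalized b k g) (i : Fin 4) (j : ℕ) :
    IsLocalized b (k + j) (fun t => (_root_.partialDeriv i)^[j] (g t)) := by
  induction j with
  | zero => exact h
  | succ j ih =>
    simp only [Function.iterate_succ_apply']
    exact ih.partialDeriv i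

lemma IsLocalized.exists_bound {b : ℝ} {k : ℕ} {g : ℝ → (Fin 4 → ℝ) → ℂ} (h : IsLocalized b k g)
    (N : ℕ) : ∃ C, 0 ≤ C ∧ ∀ t, 0 < t → t ≤ b → ∀ x y : ℝ × ℝ,
      ‖g t ![x.1, x.2, y.1, y.2]‖ * t ^ (2 + k) *
        (1 + gd (sphCoords x.1 x.2) (sphCoords y.1 y.2) / t) ^ N ≤ C := by
  obtain ⟨C₀, hC₀0, hC₀⟩ := h.2 0
  obtain ⟨C₁, hC₁0, hC₁⟩ := h.2 N
  refine ⟨20 ^ N * (C₀ + C₁), by positivity, fun t ht htb x y => ?_⟩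
  have hd := gd_sq_le x y
  have hd0 : 0 ≤ gd (sphCoords x.1 x.2) (sphCoords y.1 y.2) := Real.arccos_nonneg _
  have h0 := hC₀ t ht htb ![x.1, x.2, y.1, y.2]
  have h1 := hC₁ t ht htb ![x.1, x.2, y.1, y.2]
  have hw := (chordSq_nonneg_and_le ![x.1, x.2, y.1, y.2]).1
  set d := gd (sphCoords x.1 x.2) (sphCoords y.1 y.2)
  set w := chordSq ![x.1, x.2, y.1, y.2]
  set q := ‖g t ![x.1, x.2, y.1, y.2]‖ * t ^ (2 + k) with hq
  have hq0 : 0 ≤ q := by positivity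
  rw [mul_assoc, ← hq] at h0 h1
  have h2 : 1 + d / t ≤ 10 * (1 + w / t ^ 2) := by
    have e1 : (d / t) ^ 2 ≤ 5 * (w / t ^ 2) := by
      rw [div_pow, ← mul_div_assoc]
      gcongr
    nlinarith [sq_nonneg (1 - d / t)]
  have h3 : (1 + w / t ^ 2) ^ N ≤ 2 ^ N * (1 + (w / t ^ 2) ^ N) := by
    have := add_pow_le (zero_le_one (α := ℝ)) (show 0 ≤ w / t ^ 2 by positivity) N
    rw [one_pow] at this
    refine this.trans ?_
    gcongr
    · norm_num
    · omega
  have h4 : q * (w / t ^ 2) ^ N ≤ C₁ := by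
    rw [div_pow, ← pow_mul, ← mul_div_assoc, div_le_iff₀ (by positivity)]
    linarith
  simp only [pow_zero, one_mul, mul_zero, mul_one] at h0
  calc q * (1 + d / t) ^ N ≤ q * (10 * (1 + w / t ^ 2)) ^ N := by gcongr
    _ = 10 ^ N * q * (1 + w / t ^ 2) ^ N := by rw [mul_pow]; ring
    _ ≤ 10 ^ N * q * (2 ^ N * (1 + (w / t ^ 2) ^ N)) := by gcongr
    _ = 20 ^ N * (q + q * (w / t ^ 2) ^ N) := by
        rw [show (20 : ℝ) = 10 * 2 by norm_num, mul_pow]; ring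
    _ ≤ 20 ^ N * (C₀ + C₁) := by gcongr

end Localization

section Chart

variable {e : ℝ × ℝ → Fin 4 → ℝ} {i j : Fin 4} {g : ℝ × ℝ → ℂ} {H : (Fin 4 → ℝ) → ℂ}

lemma iterate_pdθ_eq (he : ∀ x r, e (r, x.2) = Function.update (e x) i r) (hi : ∀ x, e x i = x.1)
    (hg : ∀ x : ℝ × ℝ, x.1 ∈ Set.Ioo 0 Real.pi → g x = H (e x)) (k : ℕ) {x : ℝ × ℝ}
    (hx : x.1 ∈ Set.Ioo 0 Real.pi) : pdθ^[k] g x = (partialDeriv i)^[k] H (e x) := by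
  induction k generalizing x with
  | zero => exact hg x hx
  | succ k ih =>
    rw [Function.iterate_succ_apply', Function.iterate_succ_apply', pdθ, partialDeriv, hi]
    refine Filter.EventuallyEq.deriv_eq ?_
    filter_upwards [isOpen_Ioo.mem_nhds hx] with r hr
    rw [ih (x := (r, x.2)) hr, he]

lemma iterate_pdφ_eq (he : ∀ x r, e (x.1, r) = Function.update (e x) j r) (hj : ∀ x, e x j = x.2)
    (hg : ∀ x : ℝ × ℝ, x.1 ∈ Set.Ioo 0 Real.pi → g x = H (e x)) (k : ℕ) {x : ℝ × ℝ}
    (hx : x.1 ∈ Set.Ioo 0 Real.pi) : pdφ^[k] g x = (partialDeriv j)^[k] H (e x) := by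
  induction k generalizing x with
  | zero => exact hg x hx
  | succ k ih =>
    rw [Function.iterate_succ_apply', Function.iterate_succ_apply', pdφ, partialDeriv, hj]
    refine congrArg (fun F : ℝ → ℂ => deriv F x.2) (funext fun r => ?_)
    rw [ih (x := (x.1, r)) hx, he]

lemma tsum_eq_spinKernel {f : ℝ → ℂ} {A B : ℝ} (hsupp : ∀ u : ℝ, f u ≠ 0 → u ∈ Set.Icc A B)
    (s : ℤ) {t : ℝ} (ht : 0 < t) {x y : ℝ × ℝ} (hx : x.1 ∈ Set.Ioo 0 Real.pi)
    (hy : y.1 ∈ Set.Ioo 0 Real.pi) :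
    ∑' n : ℕ, f (t ^ 2 * ((lam s (|s| + (n : ℤ)) : ℤ) : ℝ)) *
      ∑ m ∈ Finset.Icc (-(|s| + (n : ℤ))) (|s| + (n : ℤ)),
        sY s (|s| + (n : ℤ)) m x * (starRingEnd ℂ) (sY s (|s| + (n : ℤ)) m y) =
      spinKernel s f B t ![x.1, x.2, y.1, y.2] := by
  have hsin : ∀ θ ∈ Set.Ioo 0 Real.pi, Real.sin (θ / 2) ≠ 0 := fun θ hθ =>
    (Real.sin_pos_of_pos_of_lt_pi (by linarith [hθ.1]) (by linarith [hθ.1, hθ.2])).ne'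
  rw [tsum_eq_sum (s := Finset.range (cutoff B t)), spinKernel, Finset.sum_apply]
  · refine Finset.sum_congr rfl fun n _ => ?_
    have habs := Int.natCast_natAbs s
    rw [sum_sY_mul_conj (p := n + (|s| + s).toNat) (q := n + (|s| - s).toNat) (by omega) (by omega)
      (hsin _ hx) (hsin _ hy), Pi.smul_apply, smul_eq_mul, spinZonal, kernelCoeff, mul_assoc]
    congr 4
    rw [← habs]
    generalize s.natAbs = S
    push_cast
    ring
  · intro n hn
    have h := kernelCoeff_eq_zero_of_cutoff_le hsupp (s := s) ht
      (n := n) (by simpa using hn)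
    rw [kernelCoeff] at h
    rw [h, zero_mul]

end Chart

lemma spinKernel_eq_zero {f : ℝ → ℂ} {A B : ℝ} (hA : 0 < A)
    (hsupp : ∀ u : ℝ, f u ≠ 0 → u ∈ Set.Icc A B) (s : ℤ) {t : ℝ} (ht : √B < t) :
    spinKernel s f B t = 0 :=
  Finset.sum_eq_zero fun n _ => by
    rw [kernelCoeff_eq_zero_of_lt hA hsupp ht, zero_mul, zero_smul]

lemma iterate_partialDeriv_zero (i : Fin 4) (k : ℕ) :
    (partialDeriv i)^[k] (0 : (Fin 4 → ℝ) → ℂ) = 0 :=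
  Function.iterate_fixed (f := partialDeriv i) (x := 0)
    (show partialDeriv i (0 : (Fin 4 → ℝ) → ℂ) = 0 from funext fun v => deriv_const (v i) (0 : ℂ)) k

/-- **Localization of the spin needlet kernel `K_t` of `f(t²Δ_s)`** (Statement 12, needlet case). -/
theorem spin_kernel_localization (s : ℤ) (f : ℝ → ℂ) (A B : ℝ) (hA : 0 < A) (hAB : A < B)
    (hf : ContDiff ℝ (⊤ : ℕ∞) f) (hsupp : ∀ u : ℝ, f u ≠ 0 → u ∈ Set.Icc A B)
    (F : Set (ℝ × ℝ)) (hFc : IsCompact F) (hFsub : F ⊆ Set.Ioo 0 Real.pi ×ˢ Set.univ)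
    (i₁ j₁ i₂ j₂ N : ℕ) :
    ∃ c : ℝ, 0 < c ∧ ∀ t : ℝ, 0 < t → ∀ x ∈ F, ∀ y ∈ F,
      ‖pdθ^[i₁] (pdφ^[j₁] (fun x' =>
          pdθ^[i₂] (pdφ^[j₂] (fun y' =>
            ∑' n : ℕ, f (t ^ 2 * ((lam s (|s| + (n : ℤ)) : ℤ) : ℝ)) *
              ∑ m ∈ Finset.Icc (-(|s| + (n : ℤ))) (|s| + (n : ℤ)),
                sY s (|s| + (n : ℤ)) m x' * (starRingEnd ℂ) (sY s (|s| + (n : ℤ)) m y'))) y)) x‖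
        ≤ c * t ^ (-(2 + (i₁ : ℤ) + j₁ + i₂ + j₂)) *
            (1 + gd (sphCoords x.1 x.2) (sphCoords y.1 y.2) / t) ^ (-(N : ℤ)) := by
  have hloc := ((((isLocalized_spinKernel hA hf hsupp s).iterate_partialDeriv 3 j₂).iterate_partialDeriv
    2 i₂).iterate_partialDeriv 1 j₁).iterate_partialDeriv 0 i₁
  obtain ⟨C, hC0, hC⟩ := hloc.exists_bound N
  refine ⟨C + 1, by positivity, fun t ht x hx y hy => ?_⟩
  have hx1 := (hFsub hx).1
  have hy1 := (hFsub hy).1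
  rw [iterate_pdθ_eq (e := fun x => ![x.1, x.2, y.1, y.2]) (i := 0)
    (H := (partialDeriv 1)^[j₁] ((partialDeriv 2)^[i₂] ((partialDeriv 3)^[j₂]
      (spinKernel s f B t)))) ?_ ?_ ?_ i₁ hx1]
  rotate_left
  · intro x r; ext l; fin_cases l <;> simp
  · intro x; simp
  · intro x hx
    refine iterate_pdφ_eq (e := fun x => ![x.1, x.2, y.1, y.2]) (j := 1) ?_ ?_ ?_ j₁ hx
    · intro x r; ext l; fin_cases l <;> simp
    · intro x; simp
    intro x hx
    refine iterate_pdθ_eq (e := fun y => ![x.1, x.2, y.1, y.2]) (i := 2) ?_ ?_ ?_ i₂ hy1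
    · intro y r; ext l; fin_cases l <;> simp
    · intro y; simp
    intro y hy
    refine iterate_pdφ_eq (e := fun y => ![x.1, x.2, y.1, y.2]) (j := 3) ?_ ?_ ?_ j₂ hy
    · intro y r; ext l; fin_cases l <;> simp
    · intro y; simp
    exact fun y hy => tsum_eq_spinKernel hsupp s ht hx hy
  have hd0 : 0 ≤ gd (sphCoords x.1 x.2) (sphCoords y.1 y.2) := Real.arccos_nonneg _
  rcases le_or_gt t (√B) with htB | htB
  · have h := hC t ht htB x y
    have hpos : 0 < 1 + gd (sphCoords x.1 x.2) (sphCoords y.1 y.2) / t := by positivity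
    rw [show (2 + (i₁ : ℤ) + j₁ + i₂ + j₂) = ((2 + (0 + j₂ + i₂ + j₁ + i₁) : ℕ) : ℤ) by
      push_cast; ring, zpow_neg, zpow_neg, zpow_natCast, zpow_natCast, ← div_eq_mul_inv,
      ← div_eq_mul_inv, le_div_iff₀ (by positivity), le_div_iff₀ (by positivity)]
    linarith
  · rw [spinKernel_eq_zero hA hsupp s htB]
    simp only [iterate_partialDeriv_zero, Pi.zero_apply, norm_zero]
    positivity
end
end

section
/- Let s ≥ 0 be an integer and l ≥ s, −l ≤ m ≤ l. Then on (0,π)×ℝ, (ð_{s−1} ∘ ⋯ ∘ ð_1 ∘ ð_0)(Y_{lm}) = √((l+s)!/(l−s)!) · ₛY_{lm}, where Y_{lm} = ₀Y_{lm} is the standard spherical harmonic (for s = 0 the composition of operators is the identity). -/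
noncomputable section

/-- The spin-raising operator `ð_s` in the standard chart. -/
noncomputable def eth (s : ℤ) (h : ℝ × ℝ → ℂ) : ℝ × ℝ → ℂ := fun x =>
  -((Real.sin x.1 : ℂ) ^ s) *
    (pdθ (fun y => (Real.sin y.1 : ℂ) ^ (-s) * h y) x +
      Complex.I / (Real.sin x.1 : ℂ) * pdφ (fun y => (Real.sin y.1 : ℂ) ^ (-s) * h y) x)

/-- The spin-lowering operator `ð̄_s` in the standard chart. -/
noncomputable def ethbar (s : ℤ) (h : ℝ × ℝ → ℂ) : ℝ × ℝ → ℂ := fun x =>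
  -((Real.sin x.1 : ℂ) ^ (-s)) *
    (pdθ (fun y => (Real.sin y.1 : ℂ) ^ s * h y) x -
      Complex.I / (Real.sin x.1 : ℂ) * pdφ (fun y => (Real.sin y.1 : ℂ) ^ s * h y) x)

/-- `ð^{[n]} = ð_{n−1} ∘ ⋯ ∘ ð_0`. -/
noncomputable def ethIter : ℕ → (ℝ × ℝ → ℂ) → (ℝ × ℝ → ℂ)
  | 0, h => h
  | n + 1, h => eth (n : ℤ) (ethIter n h)

/-! ### Integer binomial coefficients -/

theorem izbinom_natCast (n k : ℕ) : izbinom n k = n.choose k := by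
  unfold izbinom
  split_ifs with h
  · simp
  · exact (Nat.choose_eq_zero_of_lt (by omega)).symm

theorem izbinom_of_neg (n : ℤ) {j : ℤ} (hj : j < 0) : izbinom n j = 0 :=
  if_neg (by omega)

/-- Pascal's rule. -/
theorem izbinom_add_one_add_one {n : ℤ} (hn : 0 ≤ n) (j : ℤ) :
    izbinom (n + 1) (j + 1) = izbinom n j + izbinom n (j + 1) := by
  lift n to ℕ using hn
  obtain hj | hj | hj : j < -1 ∨ j = -1 ∨ 0 ≤ j := by omega
  · simp [izbinom_of_neg, show j + 1 < 0 by omega, show j < 0 by omega]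
  · subst hj
    have h₁ := izbinom_natCast (n + 1) 0
    have h₂ := izbinom_natCast n 0
    push_cast at h₁ h₂
    simp [izbinom_of_neg, h₁, h₂]
  · lift j to ℕ using hj
    exact_mod_cast (by simp only [izbinom_natCast, Nat.choose_succ_succ] :
      izbinom ((n + 1 : ℕ) : ℤ) ((j + 1 : ℕ) : ℤ) = izbinom n j + izbinom n ((j + 1 : ℕ) : ℤ))

/-- The absorption identity. -/
theorem add_one_mul_izbinom_add_one {n r : ℤ} (hn : 0 ≤ n) (hr : 0 ≤ r) :
    (r + 1) * izbinom (n + 1) (r + 1) = (n + 1) * izbinom n r := by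
  lift n to ℕ using hn
  lift r to ℕ using hr
  have h₁ := izbinom_natCast (n + 1) (r + 1)
  push_cast at h₁
  rw [h₁, izbinom_natCast]
  have := Nat.add_one_mul_choose_eq n r
  zify at this
  linarith

/-- The complementary absorption identity. -/
theorem sub_mul_izbinom_add_one {n r : ℤ} (hn : 0 ≤ n) (hr : 0 ≤ r) :
    (n + 1 - r) * izbinom (n + 1) r = (n + 1) * izbinom n r := by
  have h₁ := add_one_mul_izbinom_add_one hn hr
  have h₂ : (izbinom (n + 1) (r + 1) : ℤ) = izbinom n r + izbinom n (r + 1) := by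
    exact_mod_cast izbinom_add_one_add_one hn r
  obtain rfl | hr := hr.eq_or_lt
  · lift n to ℕ using hn
    have h₃ := izbinom_natCast (n + 1) 0
    have h₄ := izbinom_natCast n 0
    push_cast at h₃ h₄
    simp [h₃, h₄]
  · have h₃ := add_one_mul_izbinom_add_one hn (show 0 ≤ r - 1 by omega)
    have h₄ : (izbinom (n + 1) (r - 1 + 1) : ℤ) = izbinom n (r - 1) + izbinom n (r - 1 + 1) := by
      exact_mod_cast izbinom_add_one_add_one hn (r - 1)
    simp only [sub_add_cancel] at h₃ h₄
    linear_combination (n + 1) * h₄ - h₃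

theorem Int.sum_Icc_zero_add_one_of_zero {M : Type*} [AddCommMonoid M] {n : ℤ} (hn : 0 ≤ n + 1)
    (f : ℤ → M) (h : f 0 = 0) :
    ∑ r ∈ Finset.Icc 0 (n + 1), f r = ∑ r ∈ Finset.Icc 0 n, f (r + 1) := by
  rw [← Finset.insert_Icc_add_one_left_eq_Icc hn, Finset.sum_insert (by simp), h, zero_add,
    ← Finset.map_add_right_Icc, Finset.sum_map]
  rfl

theorem Int.sum_Icc_zero_add_one_of_last {M : Type*} [AddCommMonoid M] {n : ℤ} (hn : 0 ≤ n + 1)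
    (f : ℤ → M) (h : f (n + 1) = 0) :
    ∑ r ∈ Finset.Icc 0 (n + 1), f r = ∑ r ∈ Finset.Icc 0 n, f r := by
  have : Finset.Icc 0 (n + 1) = insert (n + 1) (Finset.Icc 0 n) := by
    ext; simp; omega
  rw [this, Finset.sum_insert (by simp), h, zero_add]

/-- The recursion in `s` for the sums defining the spin-weighted spherical harmonics. -/
theorem sum_izbinom_mul_zpow_spin_add_one {s l : ℤ} (m : ℤ) (hs : -l ≤ s) (hl : s + 1 ≤ l) (z : ℂ) :
    ∑ r ∈ Finset.Icc (0 : ℤ) (l - s),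
      (izbinom (l - s) r : ℂ) * (izbinom (l + s) (r + s - m) : ℂ) * (-1 : ℂ) ^ (l - r - s) *
        (r * z ^ (2 * r + s - m - 1) - (l - s - r) * z ^ (2 * r + s - m + 1)) =
    (l - s) * ∑ r ∈ Finset.Icc (0 : ℤ) (l - (s + 1)),
      (izbinom (l - (s + 1)) r : ℂ) * (izbinom (l + (s + 1)) (r + (s + 1) - m) : ℂ) *
        (-1 : ℂ) ^ (l - r - (s + 1)) * z ^ (2 * r + (s + 1) - m) := by
  obtain ⟨n, rfl⟩ : ∃ n, l = n + 1 + s := ⟨l - s - 1, by ring⟩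
  have hn : 0 ≤ n := by omega
  simp only [mul_sub, Finset.sum_sub_distrib]
  rw [show n + 1 + s - s = n + 1 by ring, show n + 1 + s - (s + 1) = n by ring,
    Int.sum_Icc_zero_add_one_of_zero (by omega) _ (by simp),
    Int.sum_Icc_zero_add_one_of_last (by omega) _ (by push_cast; ring),
    ← Finset.sum_sub_distrib, Finset.mul_sum]
  refine Finset.sum_congr rfl fun r hr => ?_
  have hr := (Finset.mem_Icc.1 hr).1
  have h₁ : ((r : ℂ) + 1) * izbinom (n + 1) (r + 1) = (n + 1) * izbinom n r := by
    exact_mod_cast add_one_mul_izbinom_add_one hn hr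
  have h₂ : ((n : ℂ) + 1 - r) * izbinom (n + 1) r = (n + 1) * izbinom n r := by
    exact_mod_cast sub_mul_izbinom_add_one hn hr
  have h₃ : (izbinom (n + 1 + s + (s + 1)) (r + (s + 1) - m) : ℂ) =
      izbinom (n + 1 + s + s) (r + s - m) + izbinom (n + 1 + s + s) (r + 1 + s - m) := by
    have := izbinom_add_one_add_one (show 0 ≤ n + 1 + s + s by omega) (r + s - m)
    rw [show r + s - m + 1 = r + 1 + s - m by ring] at this
    rw [show n + 1 + s + (s + 1) = n + 1 + s + s + 1 by ring,
      show r + (s + 1) - m = r + 1 + s - m by ring]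
    exact_mod_cast this
  have h₄ : (-1 : ℂ) ^ (n + 1 + s - r - s) = -(-1 : ℂ) ^ (n - r) := by
    rw [show n + 1 + s - r - s = n - r + 1 by ring, zpow_add_one₀ (by norm_num)]
    ring
  rw [h₃, h₄, show n + 1 + s - (r + 1) - s = n - r by ring,
    show n + 1 + s - r - (s + 1) = n - r by ring,
    show 2 * (r + 1) + s - m - 1 = 2 * r + (s + 1) - m by ring,
    show 2 * r + s - m + 1 = 2 * r + (s + 1) - m by ring]
  push_cast
  linear_combination (izbinom (n + 1 + s + s) (r + 1 + s - m) * (-1 : ℂ) ^ (n - r) *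
      z ^ (2 * r + (s + 1) - m)) * h₁ +
    (izbinom (n + 1 + s + s) (r + s - m) * (-1 : ℂ) ^ (n - r) * z ^ (2 * r + (s + 1) - m)) * h₂

/-! ### The spin-raising operator -/

theorem isOpen_strip : IsOpen {x : ℝ × ℝ | x.1 ∈ Set.Ioo 0 Real.pi} :=
  isOpen_Ioo.preimage continuous_fst

theorem eth_congr {s : ℤ} {f g : ℝ × ℝ → ℂ} {x : ℝ × ℝ} (h : f =ᶠ[nhds x] g) :
    eth s f x = eth s g x := by
  have hθ : (fun t : ℝ => (Real.sin t : ℂ) ^ (-s) * f (t, x.2)) =ᶠ[nhds x.1]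
      fun t => (Real.sin t : ℂ) ^ (-s) * g (t, x.2) := by
    have : Filter.Tendsto (fun t : ℝ => (t, x.2)) (nhds x.1) (nhds x) :=
      Continuous.tendsto (by fun_prop) _
    filter_upwards [this.eventually h] with t ht
    rw [ht]
  have hφ : (fun t : ℝ => (Real.sin x.1 : ℂ) ^ (-s) * f (x.1, t)) =ᶠ[nhds x.2]
      fun t => (Real.sin x.1 : ℂ) ^ (-s) * g (x.1, t) := by
    have : Filter.Tendsto (fun t : ℝ => (x.1, t)) (nhds x.2) (nhds x) :=
      Continuous.tendsto (by fun_prop) _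
    filter_upwards [this.eventually h] with t ht
    rw [ht]
  simp only [eth, pdθ, pdφ]
  rw [hθ.deriv_eq, hφ.deriv_eq]

theorem eth_const_mul (s : ℤ) (c : ℂ) (f : ℝ × ℝ → ℂ) (x : ℝ × ℝ) :
    eth s (fun y => c * f y) x = c * eth s f x := by
  simp only [eth, pdθ, pdφ, mul_left_comm _ c, deriv_const_mul_field]
  ring

/-- The action of `ð_s` on a function of the form `e^{imφ} g(θ)`. -/
theorem eth_exp_mul (s m : ℤ) {g : ℝ → ℂ} {g' : ℂ} {x : ℝ × ℝ} (hx : Real.sin x.1 ≠ 0)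
    (hg : HasDerivAt g g' x.1) :
    eth s (fun y => Complex.exp (Complex.I * m * y.2) * g y.1) x =
      Complex.exp (Complex.I * m * x.2) *
        -(g' - (s * Real.cos x.1 + m) / Real.sin x.1 * g x.1) := by
  have hx' : (Real.sin x.1 : ℂ) ≠ 0 := by exact_mod_cast hx
  have hsin : HasDerivAt (fun t : ℝ => (Real.sin t : ℂ) ^ (-s))
      ((-s : ℤ) * (Real.sin x.1 : ℂ) ^ (-s - 1) * Real.cos x.1) x.1 :=
    HasDerivAt.comp (h₂ := fun z : ℂ => z ^ (-s)) x.1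
      (hasDerivAt_zpow (-s) (Real.sin x.1 : ℂ) (.inl hx'))
      (Real.hasDerivAt_sin x.1).ofReal_comp
  have hexp : HasDerivAt (fun t : ℝ => Complex.exp (Complex.I * m * t))
      (Complex.exp (Complex.I * m * x.2) * (Complex.I * m * 1)) x.2 :=
    ((Complex.ofRealCLM.hasDerivAt (x := x.2)).const_mul (Complex.I * m : ℂ)).cexp
  simp only [eth, pdθ, pdφ]
  rw [(hsin.fun_mul (hg.const_mul (Complex.exp (Complex.I * m * x.2)))).deriv,
    ((hexp.mul_const (g x.1)).const_mul ((Real.sin x.1 : ℂ) ^ (-s))).deriv]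
  rw [zpow_sub_one₀ hx', zpow_neg]
  have hz : (Real.sin x.1 : ℂ) ^ s ≠ 0 := zpow_ne_zero _ hx'
  push_cast at hx' hz ⊢
  field_simp
  linear_combination (-(m : ℂ) * g x.1) * Complex.I_sq

theorem hasDerivAt_sin_half_zpow_mul_cot_half_zpow (l k : ℤ) {θ : ℝ} (hS : Real.sin (θ / 2) ≠ 0)
    (hC : Real.cos (θ / 2) ≠ 0) :
    HasDerivAt (fun t : ℝ => Real.sin (t / 2) ^ (2 * l) *
        (Real.cos (t / 2) / Real.sin (t / 2)) ^ k)
      (Real.sin (θ / 2) ^ (2 * l) * (Real.cos (θ / 2) / Real.sin (θ / 2)) ^ k *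
        (l * (Real.cos (θ / 2) / Real.sin (θ / 2)) -
          k / (2 * Real.sin (θ / 2) * Real.cos (θ / 2)))) θ := by
  have hsin : HasDerivAt (fun t : ℝ => Real.sin (t / 2)) (Real.cos (θ / 2) * (1 / 2)) θ :=
    ((hasDerivAt_id θ).div_const 2).sin
  have hcos : HasDerivAt (fun t : ℝ => Real.cos (t / 2)) (-Real.sin (θ / 2) * (1 / 2)) θ :=
    ((hasDerivAt_id θ).div_const 2).cos
  have hq : Real.cos (θ / 2) / Real.sin (θ / 2) ≠ 0 := div_ne_zero hC hS
  have h := ((hasDerivAt_zpow (2 * l) _ (.inl hS)).comp θ hsin).mul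
    ((hasDerivAt_zpow k _ (.inl hq)).comp θ (hcos.div hsin hS))
  refine h.congr_deriv ?_
  simp only [Function.comp_apply, Pi.div_apply]
  rw [zpow_sub_one₀ hS, zpow_sub_one₀ hq]
  push_cast
  field_simp
  linear_combination (-(k : ℝ)) * Real.sin_sq_add_cos_sq (θ / 2)

theorem Int.cast_factorial_toNat_add_one {n : ℤ} (hn : 0 ≤ n) :
    ((n + 1).toNat.factorial : ℝ) = (n + 1) * n.toNat.factorial := by
  lift n to ℕ using hn
  rw [← Nat.cast_succ, Int.toNat_natCast, Int.toNat_natCast, Nat.factorial_succ]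
  push_cast
  ring

theorem sub_div_sqrt_factorial_mul_factorial {s l : ℤ} (hs : -l ≤ s) (hl : s + 1 ≤ l) :
    ((l : ℝ) - s) / Real.sqrt (((l + s).toNat.factorial : ℝ) * (l - s).toNat.factorial) =
      Real.sqrt ((l - s) * (l + s + 1)) /
        Real.sqrt (((l + (s + 1)).toNat.factorial : ℝ) * (l - (s + 1)).toNat.factorial) := by
  have h₁ := Int.cast_factorial_toNat_add_one (show 0 ≤ l + s by omega)
  have h₂ := Int.cast_factorial_toNat_add_one (show 0 ≤ l - (s + 1) by omega)
  rw [show l - (s + 1) + 1 = l - s by ring] at h₂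
  rw [← add_assoc, h₁, h₂]
  have hp : (0 : ℝ) < l - s := by exact_mod_cast (show 0 < l - s by omega)
  have hq : (0 : ℝ) < l + s + 1 := by exact_mod_cast (show 0 < l + s + 1 by omega)
  have ha : (0 : ℝ) < (l + s).toNat.factorial := by exact_mod_cast Nat.factorial_pos _
  have hb : (0 : ℝ) < (l - (s + 1)).toNat.factorial := by exact_mod_cast Nat.factorial_pos _
  push_cast
  rw [sub_add_eq_sub_sub, sub_add_cancel, div_eq_div_iff (by positivity) (by positivity),
    ← Real.sqrt_mul (by positivity)]
  nth_rewrite 1 [← Real.sqrt_sq hp.le]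
  rw [← Real.sqrt_mul (by positivity)]
  congr 1
  ring

theorem sqrt_factorial_div_factorial_mul_sqrt {s l : ℤ} (hs : -l ≤ s) (hl : s + 1 ≤ l) :
    Real.sqrt (((l + s).toNat.factorial : ℝ) / (l - s).toNat.factorial) *
        Real.sqrt ((l - s) * (l + s + 1)) =
      Real.sqrt (((l + (s + 1)).toNat.factorial : ℝ) / (l - (s + 1)).toNat.factorial) := by
  have h₁ := Int.cast_factorial_toNat_add_one (show 0 ≤ l + s by omega)
  have h₂ := Int.cast_factorial_toNat_add_one (show 0 ≤ l - (s + 1) by omega)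
  rw [show l - (s + 1) + 1 = l - s by ring] at h₂
  have hp : (l : ℝ) - s ≠ 0 := by exact_mod_cast (show l - s ≠ 0 by omega)
  have hb : ((l - (s + 1)).toNat.factorial : ℝ) ≠ 0 := by exact_mod_cast Nat.factorial_ne_zero _
  rw [← Real.sqrt_mul (by positivity), ← add_assoc, h₁, h₂]
  congr 1
  push_cast
  rw [sub_add_eq_sub_sub, sub_add_cancel]
  field_simp

/-- The spin-raising operator maps `ₛY_{lm}` to a multiple of `ₛ₊₁Y_{lm}`. -/
theorem eth_sY {s l : ℤ} (m : ℤ) (hs : -l ≤ s) (hl : s + 1 ≤ l) {x : ℝ × ℝ}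
    (hx : x.1 ∈ Set.Ioo 0 Real.pi) :
    eth s (sY s l m) x = (Real.sqrt ((l - s) * (l + s + 1)) : ℂ) * sY (s + 1) l m x := by
  have hS : Real.sin (x.1 / 2) ≠ 0 :=
    (Real.sin_pos_of_pos_of_lt_pi (by linarith [hx.1]) (by linarith [hx.1, hx.2])).ne'
  have hC : Real.cos (x.1 / 2) ≠ 0 :=
    (Real.cos_pos_of_mem_Ioo ⟨by linarith [hx.1, hx.2], by linarith [hx.2]⟩).ne'
  have hcos : Real.cos x.1 = Real.cos (x.1 / 2) ^ 2 - Real.sin (x.1 / 2) ^ 2 := by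
    rw [← Real.cos_two_mul', mul_div_cancel₀ _ two_ne_zero]
  have hsin : Real.sin x.1 = 2 * Real.sin (x.1 / 2) * Real.cos (x.1 / 2) := by
    rw [← Real.sin_two_mul, mul_div_cancel₀ _ two_ne_zero]
  set K : ℂ := (-1 : ℂ) ^ (max (-m) 0) * ((alm l m /
    Real.sqrt (((l + s).toNat.factorial : ℝ) * ((l - s).toNat.factorial : ℝ)) : ℝ) : ℂ) with hK
  set c : ℤ → ℂ := fun r => (izbinom (l - s) r : ℂ) * (izbinom (l + s) (r + s - m) : ℂ) *
    (-1 : ℂ) ^ (l - r - s) with hc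
  have hY : sY s l m = fun y => Complex.exp (Complex.I * m * y.2) *
      (K * ∑ r ∈ Finset.Icc (0 : ℤ) (l - s), c r * ((Real.sin (y.1 / 2) ^ (2 * l) *
        (Real.cos (y.1 / 2) / Real.sin (y.1 / 2)) ^ (2 * r + s - m) : ℝ) : ℂ)) := by
    funext y
    simp only [sY, hK, hc, Finset.mul_sum]
    refine Finset.sum_congr rfl fun r _ => ?_
    push_cast
    ring
  have hg := (HasDerivAt.fun_sum (u := Finset.Icc (0 : ℤ) (l - s)) fun r _ =>
    ((hasDerivAt_sin_half_zpow_mul_cot_half_zpow l (2 * r + s - m) hS hC).ofReal_comp).const_mul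
      (c r)).const_mul K
  rw [hY, eth_exp_mul s m (Real.sin_pos_of_mem_Ioo hx).ne' hg]
  have hterm : ∀ r : ℤ,
      -(Real.sin (x.1 / 2) ^ (2 * l) *
          (Real.cos (x.1 / 2) / Real.sin (x.1 / 2)) ^ (2 * r + s - m) *
          (l * (Real.cos (x.1 / 2) / Real.sin (x.1 / 2)) -
            (2 * r + s - m : ℤ) / (2 * Real.sin (x.1 / 2) * Real.cos (x.1 / 2))) -
        (s * Real.cos x.1 + m) / Real.sin x.1 * (Real.sin (x.1 / 2) ^ (2 * l) *
          (Real.cos (x.1 / 2) / Real.sin (x.1 / 2)) ^ (2 * r + s - m))) =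
      Real.sin (x.1 / 2) ^ (2 * l) *
        (r * (Real.cos (x.1 / 2) / Real.sin (x.1 / 2)) ^ (2 * r + s - m - 1) -
          (l - s - r) * (Real.cos (x.1 / 2) / Real.sin (x.1 / 2)) ^ (2 * r + s - m + 1)) := by
    intro r
    have hq : Real.cos (x.1 / 2) / Real.sin (x.1 / 2) ≠ 0 := div_ne_zero hC hS
    rw [zpow_sub_one₀ hq, zpow_add_one₀ hq, hcos, hsin]
    push_cast
    field_simp
    linear_combination (-s - 2 * r : ℝ) * Real.sin_sq_add_cos_sq (x.1 / 2)
  have hsum := sum_izbinom_mul_zpow_spin_add_one m hs hl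
    ((Real.cos (x.1 / 2) / Real.sin (x.1 / 2) : ℝ) : ℂ)
  have hnorm : (l - s : ℂ) * ((alm l m /
      Real.sqrt (((l + s).toNat.factorial : ℝ) * ((l - s).toNat.factorial : ℝ)) : ℝ) : ℂ) =
      (Real.sqrt ((l - s) * (l + s + 1)) : ℂ) * ((alm l m / Real.sqrt
        (((l + (s + 1)).toNat.factorial : ℝ) * ((l - (s + 1)).toNat.factorial : ℝ)) : ℝ) : ℂ) := by
    have := sub_div_sqrt_factorial_mul_factorial hs hl
    rw [← Complex.ofReal_intCast l, ← Complex.ofReal_intCast s]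
    norm_cast
    push_cast
    linear_combination alm l m * this
  calc
    _ = Complex.exp (Complex.I * m * x.2) * (K * ((Real.sin (x.1 / 2) : ℂ) ^ (2 * l) *
        ∑ r ∈ Finset.Icc (0 : ℤ) (l - s), c r *
        (r * ((Real.cos (x.1 / 2) / Real.sin (x.1 / 2) : ℝ) : ℂ) ^ (2 * r + s - m - 1) -
          (l - s - r) *
            ((Real.cos (x.1 / 2) / Real.sin (x.1 / 2) : ℝ) : ℂ) ^ (2 * r + s - m + 1)))) := by
      congr 1
      rw [mul_left_comm _ K, ← mul_sub, ← mul_neg, Finset.mul_sum, ← Finset.sum_sub_distrib,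
        ← Finset.sum_neg_distrib, Finset.mul_sum (a := (Real.sin (x.1 / 2) : ℂ) ^ (2 * l))]
      congr 1
      refine Finset.sum_congr rfl fun r _ => ?_
      have := congrArg (fun t : ℝ => (t : ℂ)) (hterm r)
      push_cast at this ⊢
      linear_combination c r * this
    _ = _ := by
      rw [hsum, sY, hK]
      linear_combination (Complex.exp (Complex.I * m * x.2) * (-1 : ℂ) ^ (max (-m) 0) *
        (Real.sin (x.1 / 2) : ℂ) ^ (2 * l) * ∑ r ∈ Finset.Icc (0 : ℤ) (l - (s + 1)),
          (izbinom (l - (s + 1)) r : ℂ) * (izbinom (l + (s + 1)) (r + (s + 1) - m) : ℂ) *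
          (-1 : ℂ) ^ (l - r - (s + 1)) *
          ((Real.cos (x.1 / 2) / Real.sin (x.1 / 2) : ℝ) : ℂ) ^ (2 * r + (s + 1) - m)) * hnorm

/-- **`ð^s Y_{lm} = √((l+s)!/(l−s)!) ₛY_{lm}` for `s ≥ 0`** (Statement 19). -/
theorem ethIter_Y (s l m : ℤ) (hs : 0 ≤ s) (hl : s ≤ l) (hm : -l ≤ m) (hm' : m ≤ l) :
    ∀ x : ℝ × ℝ, x.1 ∈ Set.Ioo 0 Real.pi →
      ethIter s.toNat (sY 0 l m) x =
        (Real.sqrt (((l + s).toNat.factorial : ℝ) / ((l - s).toNat.factorial : ℝ)) : ℂ) *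
          sY s l m x := by
  lift s to ℕ using hs
  rw [Int.toNat_natCast]
  induction s with
  | zero =>
    intro x _
    have : ((l.toNat.factorial : ℝ)) ≠ 0 := by exact_mod_cast Nat.factorial_ne_zero _
    simp [ethIter, div_self this]
  | succ n ih =>
    intro x hx
    push_cast at hl ⊢
    have heq : ethIter n (sY 0 l m) =ᶠ[nhds x] fun y => (Real.sqrt
        (((l + n).toNat.factorial : ℝ) / ((l - n).toNat.factorial : ℝ)) : ℂ) * sY n l m y := by
      filter_upwards [isOpen_strip.mem_nhds hx] with y hy
      exact ih (by omega) y hy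
    rw [ethIter, eth_congr heq, eth_const_mul, eth_sY m (by omega) hl hx,
      ← sqrt_factorial_div_factorial_mul_sqrt (by omega) hl]
    push_cast
    ring
end
end
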